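/- arXiv:2404.17289 — 3 statements merged into one kernel-verified Lean document; each statement's English description precedes it below -/
import Mathlib

section
/- Let X be a complex Banach space and T : X → X a power-bounded operator with σ(T) ∩ 𝕋 ⊆ {1}. If x ∈ X lies in the closure of Ran(I − T), then ‖Tⁿx‖ → 0 as n → ∞. -/
open Filter Topology

noncomputable section

open MeasureTheory Set

def ee (k : ℤ) (v : ℝ) : ℂ := Complex.exp (((-2 * Real.pi * v * k : ℝ) : ℂ) * Complex.I)

lemma ee_cont (k : ℤ) : Continuous (ee k) := by unfold ee; fun_prop

lemma ee_norm (k : ℤ) (v : ℝ) : ‖ee k v‖ = 1 := Complex.norm_exp_ofReal_mul_I _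

lemma ee_add (k l : ℤ) (v : ℝ) : ee (k + l) v = ee k v * ee l v := by
  unfold ee; rw [← Complex.exp_add]; push_cast; ring_nf

lemma ee_zero (v : ℝ) : ee 0 v = 1 := by simp [ee]

lemma ee_pow (k : ℕ) (v : ℝ) : ee 1 v ^ k = ee k v := by
  induction k with
  | zero => simp [ee_zero]
  | succ k ih => rw [pow_succ, ih, ← ee_add]; push_cast; rfl

abbrev Iu : Set ℝ := Ioc (-1/2 : ℝ) (1/2)

lemma ee_int (k : ℤ) : ∫ v in Iu, ee k v = if k = 0 then 1 else 0 := by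
  split_ifs with h
  · subst h; simp [ee_zero]; norm_num
  · have hc : ((-2 * Real.pi * k : ℂ) * Complex.I) ≠ 0 := by
      simp [h, Real.pi_ne_zero]
    have := integral_exp_mul_complex (a := -1/2) (b := 1/2) hc
    rw [intervalIntegral.integral_of_le (by norm_num)] at this
    have e1 : ∀ v : ℝ, ee k v = Complex.exp ((-2 * Real.pi * k : ℂ) * Complex.I * v) := by
      intro v; unfold ee; push_cast; ring_nf
    simp_rw [e1]
    rw [this, div_eq_zero_iff]; left
    rw [sub_eq_zero, Complex.exp_eq_exp_iff_exists_int]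
    refine ⟨-k, ?_⟩
    push_cast; ring

lemma ee_deriv (v : ℝ) : HasDerivAt (fun v => 1 - ee (-1) v)
    (-(2 * Real.pi * Complex.I) * ee (-1) v) v := by
  have h0 : HasDerivAt (fun v : ℝ => ((-2 * Real.pi * v * (-1 : ℤ) : ℝ) : ℂ)) (2 * Real.pi : ℝ) v := by
    apply HasDerivAt.ofReal_comp
    have := (hasDerivAt_id v).const_mul (2 * Real.pi)
    simp only [id, mul_one] at this
    refine this.congr_of_eventuallyEq (Eventually.of_forall fun y => ?_)
    push_cast; ring
  have h1 := (h0.mul_const Complex.I).cexp.const_sub 1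
  refine h1.congr_deriv ?_
  unfold ee; push_cast; ring

lemma ee_deriv2 (v : ℝ) : HasDerivAt (fun v => -(2 * Real.pi * Complex.I) * ee (-1) v)
    ((2 * Real.pi * Complex.I) * (-(2 * Real.pi * Complex.I) * ee (-1) v)) v := by
  have := ((ee_deriv v).const_sub 1).const_mul (-(2 * Real.pi * Complex.I))
  simp only [sub_sub_cancel] at this
  refine this.congr_deriv ?_
  ring

lemma ee_small (v : ℝ) : ‖1 - ee (-1) v‖ ≤ 2 * Real.pi * |v| := by
  have := Real.norm_exp_I_mul_ofReal_sub_one_le (x := 2 * Real.pi * v)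
  rw [norm_sub_rev]
  have e : ee (-1) v = Complex.exp (Complex.I * (2 * Real.pi * v : ℝ)) := by
    unfold ee; push_cast; ring_nf
  rw [e]
  refine this.trans ?_
  rw [Real.norm_eq_abs, abs_mul, abs_of_pos (by positivity)]

lemma bump : ∃ (c c1 c2 : ℝ → ℂ) (K : ℝ), (∀ s, HasDerivAt c (c1 s) s) ∧ (∀ s, HasDerivAt c1 (c2 s) s)
    ∧ Continuous c2 ∧ (∀ s, ‖c s‖ ≤ K) ∧ (∀ s, ‖c1 s‖ ≤ K) ∧ (∀ s, ‖c2 s‖ ≤ K) ∧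
    (∀ s, 2 < |s| → c s = 0) ∧ (∀ s, 2 < |s| → c1 s = 0) ∧ (∀ s, 2 < |s| → c2 s = 0) ∧
    (∀ s, |s| ≤ 1 → c s = 1) := by
  let φ : ContDiffBump (0 : ℝ) := ⟨1, 2, one_pos, one_lt_two⟩
  let c : ℝ → ℂ := fun s => (φ s : ℂ)
  have hc : ContDiff ℝ 2 c := Complex.ofRealCLM.contDiff.comp φ.contDiff
  have hz : ∀ s, 2 < |s| → s ∉ tsupport c := by
    intro s hs hm
    have h1 : tsupport c ⊆ Metric.closedBall 0 2 := by
      refine closure_minimal ?_ Metric.isClosed_closedBall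
      intro t ht
      by_contra hcon
      apply ht
      have : φ t = 0 := φ.zero_of_le_dist (by
        simp only [Metric.mem_closedBall, not_le] at hcon; exact hcon.le)
      simp [c, this]
    have := h1 hm
    simp [Metric.mem_closedBall] at this
    linarith
  have hcs : HasCompactSupport c := by
    refine HasCompactSupport.of_support_subset_isCompact (isCompact_closedBall (0:ℝ) 2) ?_
    intro s hs
    by_contra hcon
    simp at hcon
    exact hz s hcon (subset_tsupport _ hs)
  have hc1 : ContDiff ℝ 1 (deriv c) := ((contDiff_succ_iff_deriv (n := 1)).1 hc).2.2
  have hc2 : Continuous (deriv (deriv c)) := hc1.continuous_deriv le_rfl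
  obtain ⟨K0, h0⟩ := hc.continuous.bounded_above_of_compact_support hcs
  obtain ⟨K1, h1⟩ := hc1.continuous.bounded_above_of_compact_support hcs.deriv
  obtain ⟨K2, h2⟩ := hc2.bounded_above_of_compact_support hcs.deriv.deriv
  refine ⟨c, deriv c, deriv (deriv c), max K0 (max K1 K2), fun s => ?_, fun s => ?_, hc2, ?_, ?_, ?_, ?_, ?_, ?_, ?_⟩
  · exact (hc.differentiable (by norm_num) s).hasDerivAt
  · exact (hc1.differentiable (by norm_num) s).hasDerivAt
  · exact fun s => (h0 s).trans (le_max_left _ _)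
  · exact fun s => (h1 s).trans ((le_max_left _ _).trans (le_max_right _ _))
  · exact fun s => (h2 s).trans ((le_max_right _ _).trans (le_max_right _ _))
  · exact fun s hs => image_eq_zero_of_notMem_tsupport (hz s hs)
  · exact fun s hs => image_eq_zero_of_notMem_tsupport (fun h => hz s hs (tsupport_deriv_subset h))
  · exact fun s hs => image_eq_zero_of_notMem_tsupport
      (fun h => hz s hs (tsupport_deriv_subset (tsupport_deriv_subset h)))
  · intro s hs
    have : φ s = 1 := φ.one_of_mem_closedBall (by simpa [Metric.mem_closedBall] using hs)
    simp [c, this]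

open FourierTransform in
lemma four_bound (f f1 f2 : ℝ → ℂ) (d M : ℝ) (hd : 0 < d) (h1 : ∀ s, HasDerivAt f (f1 s) s)
    (h2 : ∀ s, HasDerivAt f1 (f2 s) s) (hc : Continuous f2)
    (z : ∀ s, d < |s| → f s = 0) (z1 : ∀ s, d < |s| → f1 s = 0) (z2 : ∀ s, d < |s| → f2 s = 0)
    (hM : ∀ s, ‖f2 s‖ ≤ M) (k : ℤ) (hk : k ≠ 0) :
    ‖𝓕 f (k : ℝ)‖ ≤ 2 * d * M / (k : ℝ) ^ 2 := by
  have cs : ∀ g : ℝ → ℂ, (∀ s, d < |s| → g s = 0) → HasCompactSupport g := by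
    intro g hg
    refine HasCompactSupport.of_support_subset_isCompact (isCompact_closedBall (0:ℝ) d) ?_
    intro s hs
    by_contra hcon
    simp at hcon
    exact hs (hg s hcon)
  have d1 : deriv f = f1 := funext fun s => (h1 s).deriv
  have d2 : deriv f1 = f2 := funext fun s => (h2 s).deriv
  have D : Differentiable ℝ f := fun s => (h1 s).differentiableAt
  have D1 : Differentiable ℝ f1 := fun s => (h2 s).differentiableAt
  have i0 := D.continuous.integrable_of_hasCompactSupport (cs f z) (μ := volume)
  have i1 := D1.continuous.integrable_of_hasCompactSupport (cs f1 z1) (μ := volume)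
  have i2 := hc.integrable_of_hasCompactSupport (cs f2 z2) (μ := volume)
  have e1 := congrFun (Real.fourier_deriv i0 D (d1 ▸ i1)) (k : ℝ)
  have e2 := congrFun (Real.fourier_deriv i1 D1 (d2 ▸ i2)) (k : ℝ)
  rw [d1] at e1
  rw [d2, e1] at e2
  have b : ‖𝓕 f2 (k : ℝ)‖ ≤ 2 * d * M := by
    have b1 : ‖𝓕 f2 (k : ℝ)‖ ≤ ∫ v, ‖f2 v‖ := by
      rw [Real.fourier_real_eq_integral_exp_smul]
      refine (norm_integral_le_integral_norm _).trans (le_of_eq ?_)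
      congr 1; ext v
      rw [norm_smul, Complex.norm_exp_ofReal_mul_I, one_mul]
    refine b1.trans ?_
    have : ∫ v, ‖f2 v‖ = ∫ v in Icc (-d) d, ‖f2 v‖ := by
      symm
      apply setIntegral_eq_integral_of_forall_compl_eq_zero
      intro v hv
      rw [z2 v, norm_zero]
      by_contra hcon
      exact hv (abs_le.1 (not_lt.1 hcon))
    rw [this]
    have := norm_setIntegral_le_of_norm_le_const (μ := volume) (s := Icc (-d) d) (f := fun v => ‖f2 v‖) (C := M)
      (by simp) (fun v _ => by simpa using hM v)
    refine (le_abs_self _).trans (this.trans (le_of_eq ?_))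
    simp [Measure.real]
    rw [ENNReal.toReal_ofReal (by linarith)]
    ring
  rw [e2] at b
  have kpos : (0:ℝ) < (k:ℝ) ^ 2 := by positivity
  rw [le_div_iff₀ kpos]
  refine le_trans ?_ b
  rw [norm_smul, norm_smul]
  have : ‖(2 * (Real.pi:ℂ) * Complex.I * ((k:ℝ):ℂ))‖ = 2 * Real.pi * |(k:ℝ)| := by
    simp [abs_of_pos Real.pi_pos]
  rw [this, ← sq_abs (k:ℝ)]
  have hp : 1 ≤ 2 * Real.pi := by linarith [Real.pi_gt_three]
  have : 0 ≤ ‖𝓕 f (k : ℝ)‖ * |(k:ℝ)| ^ 2 := by positivity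
  nlinarith [mul_nonneg this (mul_nonneg (sub_nonneg.2 hp) (by linarith : 0 ≤ 2 * Real.pi + 1))]

lemma cut (ε : ℝ) (hε : 0 < ε) : ∃ h : ℝ → ℂ, Continuous h ∧ (∀ᶠ v in 𝓝 0, h v = 1 - ee (-1) v) ∧
      ∀ N n : ℕ, ∑ k ∈ Finset.range N, ‖∫ v in Iu, ee ((k : ℤ) - n) v * h v‖ ≤ ε := by
  obtain ⟨c, c1, c2, K, hc, hc1, hc2, b, b1, b2, z, z1, z2, one⟩ := bump
  have hK : 0 ≤ K := (norm_nonneg _).trans (b 0)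
  let e : ℝ → ℂ := fun v => 1 - ee (-1) v
  let e1 : ℝ → ℂ := fun v => -(2 * Real.pi * Complex.I) * ee (-1) v
  let e2 : ℝ → ℂ := fun v => (2 * Real.pi * Complex.I) * (-(2 * Real.pi * Complex.I) * ee (-1) v)
  have be1 : ∀ v, ‖e1 v‖ ≤ 7 := fun v => by
    simp only [e1, norm_mul, norm_neg, ee_norm]
    simp [abs_of_pos Real.pi_pos]; linarith [Real.pi_lt_d2]
  have be2 : ∀ v, ‖e2 v‖ ≤ 49 := fun v => by
    simp only [e2, norm_mul, norm_neg, ee_norm]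
    simp [abs_of_pos Real.pi_pos]; nlinarith [Real.pi_lt_d2, Real.pi_pos]
  have be : ∀ v, ‖e v‖ ≤ 7 * |v| := fun v => by
    refine (ee_small v).trans ?_
    gcongr; linarith [Real.pi_lt_d2]
  let h : ℝ → ℝ → ℂ := fun δ v => c (v / δ) * e v
  let h1 : ℝ → ℝ → ℂ := fun δ v => c1 (v / δ) * (1 / δ : ℝ) * e v + c (v / δ) * e1 v
  let h2 : ℝ → ℝ → ℂ := fun δ v => c2 (v / δ) * (1 / δ : ℝ) * (1 / δ : ℝ) * e v
    + 2 * (c1 (v / δ) * (1 / δ : ℝ)) * e1 v + c (v / δ) * e2 v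
  have comp : ∀ (g g1 : ℝ → ℂ), (∀ s, HasDerivAt g (g1 s) s) → ∀ δ v : ℝ,
      HasDerivAt (fun v => g (v / δ)) (g1 (v / δ) * (1 / δ : ℝ)) v := by
    intro g g1 hg δ v
    have := (hg (v / δ)).scomp v ((hasDerivAt_id v).div_const δ)
    simp only [Complex.real_smul] at this
    rw [mul_comm]
    exact this
  have dh : ∀ δ v, HasDerivAt (h δ) (h1 δ v) v := fun δ v =>
    (comp c c1 hc δ v).mul (ee_deriv v)
  have dh1 : ∀ δ v, HasDerivAt (h1 δ) (h2 δ v) v := fun δ v => by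
    have := (((comp c1 c2 hc1 δ v).mul_const ((1 / δ : ℝ) : ℂ)).mul (ee_deriv v)).add
      ((comp c c1 hc δ v).mul (ee_deriv2 v))
    refine this.congr_deriv ?_
    simp only [h2, e, e1, e2]; ring
  have far : ∀ δ v : ℝ, 0 < δ → 2 * δ < |v| → 2 < |v / δ| := by
    intro δ v hδ hv
    rw [abs_div, abs_of_pos hδ, lt_div_iff₀ hδ]; exact hv
  have zh : ∀ δ v : ℝ, 0 < δ → 2 * δ < |v| → h δ v = 0 := fun δ v hδ hv => by
    simp [h, z _ (far δ v hδ hv)]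
  have zh1 : ∀ δ v : ℝ, 0 < δ → 2 * δ < |v| → h1 δ v = 0 := fun δ v hδ hv => by
    simp [h1, z _ (far δ v hδ hv), z1 _ (far δ v hδ hv)]
  have zh2 : ∀ δ v : ℝ, 0 < δ → 2 * δ < |v| → h2 δ v = 0 := fun δ v hδ hv => by
    simp [h2, z _ (far δ v hδ hv), z1 _ (far δ v hδ hv), z2 _ (far δ v hδ hv)]
  have bh2 : ∀ δ v : ℝ, 0 < δ → δ ≤ 1 → ‖h2 δ v‖ ≤ 77 * K / δ := by
    intro δ v hδ hδ1
    by_cases hv : 2 * δ < |v|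
    · rw [zh2 δ v hδ hv, norm_zero]; positivity
    push Not at hv
    have nd : ‖((1 / δ : ℝ) : ℂ)‖ = 1 / δ := by
      rw [Complex.norm_real, Real.norm_eq_abs, abs_of_pos (by positivity)]
    have t1 : ‖c2 (v / δ) * (1 / δ : ℝ) * (1 / δ : ℝ) * e v‖ ≤ K * (1 / δ) * (1 / δ) * (14 * δ) := by
      rw [norm_mul, norm_mul, norm_mul, nd]
      have := b2 (v / δ)
      have := (be v).trans (show 7 * |v| ≤ 14 * δ by linarith)
      gcongr
    have t2 : ‖2 * (c1 (v / δ) * (1 / δ : ℝ)) * e1 v‖ ≤ 2 * (K * (1 / δ)) * 7 := by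
      rw [norm_mul, norm_mul, norm_mul, nd]
      have := b1 (v / δ)
      have := be1 v
      simp only [Complex.norm_ofNat]
      gcongr
    have t3 : ‖c (v / δ) * e2 v‖ ≤ K * 49 * (1 / δ) := by
      rw [norm_mul]
      have hh : 1 ≤ 1 / δ := by rw [le_div_iff₀ hδ]; linarith
      have := mul_le_mul (b (v / δ)) (be2 v) (norm_nonneg _) hK
      nlinarith [mul_nonneg hK (sub_nonneg.2 hh)]
    refine (norm_add₃_le).trans ((add_le_add (add_le_add t1 t2) t3).trans (le_of_eq ?_))
    field_simp; ring
  have conth2 : ∀ δ, Continuous (h2 δ) := by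
    have q : ∀ g : ℝ → ℂ, Continuous g → ∀ δ : ℝ, Continuous fun v => g (v / δ) :=
      fun g hg δ => hg.comp (continuous_id.div_const δ)
    intro δ
    have a0 := q c (continuous_iff_continuousAt.2 fun s => (hc s).continuousAt) δ
    have a1 := q c1 (continuous_iff_continuousAt.2 fun s => (hc1 s).continuousAt) δ
    have a2 := q c2 hc2 δ
    have a3 := ee_cont (-1)
    exact ((((a2.mul continuous_const).mul continuous_const).mul (continuous_const.sub a3)).add
      ((continuous_const.mul (a1.mul continuous_const)).mul (continuous_const.mul a3))).add
      (a0.mul (continuous_const.mul (continuous_const.mul a3)))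
  have conth : ∀ δ, Continuous (h δ) := fun δ =>
    continuous_iff_continuousAt.2 fun s => (dh δ s).continuousAt
  have coef : ∀ δ : ℝ, 0 < δ → δ ≤ 1/8 → ∀ k : ℤ, ∫ v in Iu, ee k v * h δ v =
      FourierTransform.fourier (h δ) (k : ℝ) := by
    intro δ hδ hδ1 k
    rw [Real.fourier_real_eq_integral_exp_smul]
    refine setIntegral_eq_integral_of_forall_compl_eq_zero ?_
    intro v hv
    rw [zh δ v hδ, mul_zero]
    by_contra hcon
    have := abs_le.1 (not_lt.1 hcon)
    exact hv ⟨by linarith [this.1], by linarith [this.2]⟩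
  have bound0 : ∀ δ : ℝ, 0 < δ → ∀ k : ℤ, ‖∫ v in Iu, ee k v * h δ v‖ ≤ 14 * K * δ := by
    intro δ hδ k
    have hb : ∀ v, ‖ee k v * h δ v‖ ≤ 14 * K * δ := by
      intro v
      rw [norm_mul, ee_norm, one_mul]
      by_cases hv : 2 * δ < |v|
      · rw [zh δ v hδ hv, norm_zero]; positivity
      push Not at hv
      simp only [h, norm_mul]
      have := mul_le_mul (b (v / δ)) ((be v).trans (show 7 * |v| ≤ 14 * δ by linarith))
        (norm_nonneg _) hK
      linarith
    have := norm_setIntegral_le_of_norm_le_const (μ := volume) (s := Iu) (f := fun v => ee k v * h δ v)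
      (by simp) (fun v _ => hb v)
    refine this.trans (le_of_eq ?_)
    simp [Measure.real]; norm_num
  let B : ℤ → ℝ := fun k => 308 * K * (1 / (k : ℝ) ^ 2) + (if k = 0 then 14 * K else 0)
  have sB : Summable B := by
    refine Summable.add ?_ ?_
    · exact ((Real.summable_one_div_int_pow (p := 2)).2 (by norm_num)).mul_left _
    · exact summable_of_hasFiniteSupport ((Set.finite_singleton (0:ℤ)).subset (by
        intro k hk; by_contra hcon; simp at hcon; simp [hcon] at hk))
  have domin : ∀ δ : ℝ, 0 < δ → δ ≤ 1/8 → ∀ k : ℤ, ‖∫ v in Iu, ee k v * h δ v‖ ≤ B k := by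
    intro δ hδ hδ1 k
    by_cases hk : k = 0
    · refine (bound0 δ hδ k).trans ?_
      simp [B, hk]
      nlinarith
    · rw [coef δ hδ hδ1]
      refine (four_bound (h δ) (h1 δ) (h2 δ) (2 * δ) (77 * K / δ) (by linarith) (dh δ) (dh1 δ) (conth2 δ)
        (fun s => zh δ s hδ) (fun s => zh1 δ s hδ) (fun s => zh2 δ s hδ)
        (fun s => bh2 δ s hδ (by linarith)) k hk).trans (le_of_eq ?_)
      simp only [B, hk, if_false]
      field_simp; ring
  have near : ∀ᶠ δ : ℝ in 𝓝[>] 0, 0 < δ ∧ δ ≤ 1/8 := by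
    filter_upwards [self_mem_nhdsWithin, nhdsWithin_le_nhds (gt_mem_nhds (show (0:ℝ) < 1/8 by norm_num))]
      with δ h1 h2 using ⟨h1, le_of_lt h2⟩
  have lim : Tendsto (fun δ : ℝ => ∑' k : ℤ, ‖∫ v in Iu, ee k v * h δ v‖) (𝓝[>] 0)
      (𝓝 (∑' k : ℤ, (0:ℝ))) := by
    refine tendsto_tsum_of_dominated_convergence sB ?_ ?_
    · intro k
      refine squeeze_zero' (g := fun δ => 14 * K * δ) (Eventually.of_forall fun _ => norm_nonneg _) ?_ ?_
      · filter_upwards [near] with δ hδ using bound0 δ hδ.1 k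
      · have : Tendsto (fun δ : ℝ => 14 * K * δ) (𝓝 0) (𝓝 (14 * K * 0)) := tendsto_id.const_mul _
        rw [mul_zero] at this
        exact this.mono_left nhdsWithin_le_nhds
    · filter_upwards [near] with δ hδ k
      rw [norm_norm]; exact domin δ hδ.1 hδ.2 k
  rw [tsum_zero] at lim
  obtain ⟨δ, hδε, hδ, hδ1⟩ := ((lim.eventually (gt_mem_nhds hε)).and near).exists
  refine ⟨h δ, conth δ, ?_, fun N n => ?_⟩
  · have : Metric.closedBall (0:ℝ) δ ∈ 𝓝 (0:ℝ) := Metric.closedBall_mem_nhds _ hδ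
    filter_upwards [this] with v hv
    have hv' : |v / δ| ≤ 1 := by
      rw [abs_div, abs_of_pos hδ, div_le_one hδ]; simpa using hv
    simp [h, one _ hv', e]
  · have sm : Summable fun k : ℤ => ‖∫ v in Iu, ee k v * h δ v‖ :=
      Summable.of_nonneg_of_le (fun _ => norm_nonneg _) (domin δ hδ hδ1) sB
    refine le_trans ?_ hδε.le
    have inj : Function.Injective fun k : ℕ => (k : ℤ) - n := fun a b hab => by
      simp at hab; exact hab
    have := sm.sum_le_tsum ((Finset.range N).map ⟨_, inj⟩) (fun _ _ => norm_nonneg _)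
    rw [Finset.sum_map] at this
    exact this

section aux

variable {X : Type*} [NormedAddCommGroup X] [NormedSpace ℂ X] [CompleteSpace X]

lemma key (T : X →L[ℂ] X) (C : ℝ) (hC : ∀ n : ℕ, ‖T ^ n‖ ≤ C) (h : ℝ → ℂ) (hc : Continuous h)
    (G : ℝ → (X →L[ℂ] X)) (hGi : IntegrableOn G Iu)
    (hG : ∀ v ∈ Iu, (1 - ee 1 v • T) * G v = (1 - ee (-1) v - h v) • 1)
    (ε ε' : ℝ) (hε' : 0 < ε')
    (hε : ∀ N n : ℕ, ∑ k ∈ Finset.range N, ‖∫ v in Iu, ee ((k : ℤ) - n) v * h v‖ ≤ ε) :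
    ∀ᶠ n : ℕ in atTop, ‖T ^ n * (1 - T)‖ ≤ C * ε + ε' := by
  have hC0 : 0 ≤ C := (norm_nonneg _).trans (hC 0)
  set U : ℤ → (X →L[ℂ] X) := fun m => ∫ v in Iu, ee m v • G v with hU
  have int_ee : ∀ (m : ℤ) (F : ℝ → ℂ), Continuous F → IntegrableOn (fun v => ee m v * F v) Iu :=
    fun m F hF => ((ee_cont m).mul hF).integrableOn_Ioc
  have intU : ∀ m : ℤ, IntegrableOn (fun v => ee m v • G v) Iu := by
    intro m
    refine Integrable.bdd_smul hGi 1 (ee_cont m).aestronglyMeasurable ?_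
    exact Eventually.of_forall fun v => (ee_norm m v).le
  have RL : Tendsto U cofinite (𝓝 0) := by
    have := (Real.zero_at_infty_fourier (Iu.indicator G)).comp
      (Int.isClosedEmbedding_coe_real.tendsto_cocompact)
    rw [← cocompact_eq_cofinite ℤ]
    refine this.congr fun m => ?_
    simp only [Function.comp, hU, Real.fourier_real_eq_integral_exp_smul]
    rw [← integral_indicator measurableSet_Ioc]
    congr 1; ext1 v
    by_cases hv : v ∈ Iu
    · rw [indicator_of_mem hv, indicator_of_mem hv]; rfl
    · rw [indicator_of_notMem hv, indicator_of_notMem hv, smul_zero]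
  have RLp : Tendsto (fun n : ℕ => ‖U n‖) atTop (𝓝 0) := by
    have := (RL.comp (Nat.cofinite_eq_atTop ▸ (Nat.cast_injective (R := ℤ)).tendsto_cofinite)).norm
    simpa using this
  have RLn : Tendsto (fun n : ℕ => ‖U (-n)‖) atTop (𝓝 0) := by
    have := (RL.comp (Nat.cofinite_eq_atTop ▸
      (neg_injective.comp (Nat.cast_injective (R := ℤ))).tendsto_cofinite)).norm
    simpa using this
  have main : ∀ N n : ℕ, n + 1 < N → T ^ n * (1 - T) =
      ∑ k ∈ Finset.range N, (∫ v in Iu, ee ((k : ℤ) - n) v * h v) • T ^ k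
        + (U (-n) - T ^ N * U (N - n)) := by
    intro N n hN
    have e1 : T ^ n * (1 - T) =
        ∑ k ∈ Finset.range N, (∫ v in Iu, ee ((k : ℤ) - n) v * (1 - ee (-1) v)) • T ^ k := by
      have : ∀ k : ℕ, (∫ v in Iu, ee ((k : ℤ) - n) v * (1 - ee (-1) v))
          = (if k = n then 1 else 0) - (if k = n + 1 then 1 else 0) := by
        intro k
        have : ∀ v, ee ((k : ℤ) - n) v * (1 - ee (-1) v)
          = ee ((k : ℤ) - n) v - ee ((k : ℤ) - n + -1) v := by
          intro v; rw [ee_add]; ring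
        simp_rw [this]
        rw [integral_sub (ee_cont _).integrableOn_Ioc (ee_cont _).integrableOn_Ioc, ee_int, ee_int]
        congr 1
        · congr 1; apply propext; omega
        · congr 1; apply propext; omega
      simp_rw [this, sub_smul, ite_smul, one_smul, zero_smul, Finset.sum_sub_distrib]
      rw [Finset.sum_ite_eq', Finset.sum_ite_eq']
      rw [if_pos (by simp; omega), if_pos (by simp; omega), mul_sub, mul_one, pow_succ]
    have e2 : U (-n) - T ^ N * U (N - n) = ∑ k ∈ Finset.range N,
        (∫ v in Iu, ee ((k : ℤ) - n) v * (1 - ee (-1) v - h v)) • T ^ k := by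
      have cont1 : Continuous fun v => (1 - ee (-1) v - h v) := by
        have := ee_cont (-1); fun_prop
      have sm : ∀ k : ℕ, (∫ v in Iu, ee ((k : ℤ) - n) v * (1 - ee (-1) v - h v)) • T ^ k
          = ∫ v in Iu, (ee ((k : ℤ) - n) v * (1 - ee (-1) v - h v)) • T ^ k :=
        fun k => (integral_smul_const (μ := volume.restrict Iu) (𝕜 := ℂ)
          (fun v => ee ((k : ℤ) - n) v * (1 - ee (-1) v - h v)) (T ^ k)).symm
      rw [Finset.sum_congr rfl fun k _ => sm k]
      rw [← integral_finsetSum _ (fun k _ => (int_ee _ _ cont1).smul_const _)]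
      have : T ^ N * U (N - n) = ∫ v in Iu, T ^ N * (ee (N - n) v • G v) :=
        ((ContinuousLinearMap.mul ℂ (X →L[ℂ] X) (T ^ N)).integral_comp_comm (intU _)).symm
      have i2 : IntegrableOn (fun v => T ^ N * (ee (N - n) v • G v)) Iu :=
        (ContinuousLinearMap.mul ℂ (X →L[ℂ] X) (T ^ N)).integrable_comp (intU _)
      rw [this]
      refine (integral_sub (intU (-n)) i2).symm.trans ?_
      refine setIntegral_congr_fun measurableSet_Ioc fun v hv => ?_
      have g1 := geom_sum_mul_neg (ee 1 v • T) N
      have g2 := congrArg (fun S => ee (-n) v • (S * G v)) g1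
      simp only [mul_assoc, hG v hv] at g2
      simp only [smul_pow, ee_pow, sub_mul, one_mul, smul_sub, Finset.sum_mul, Finset.smul_sum] at g2
      have hNn : ee ((N : ℤ) - n) v = ee (-n) v * ee N v := by rw [← ee_add]; congr 1; ring
      simp only [hNn, mul_smul_comm, mul_smul]
      rw [smul_mul_assoc] at g2
      rw [← g2]
      refine Finset.sum_congr rfl fun k _ => ?_
      have hkn : ee ((k : ℤ) - n) v = ee (-n) v * ee k v := by rw [← ee_add]; congr 1; ring
      simp only [hkn, mul_smul_comm, mul_one, smul_smul]
      congr 1; ring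
    rw [e1, e2, ← Finset.sum_add_distrib]
    refine Finset.sum_congr rfl fun k _ => ?_
    rw [← add_smul]
    congr 1
    rw [← integral_add (int_ee _ _ hc) (int_ee _ _ (by have := ee_cont (-1); fun_prop))]
    congr 1; ext v; ring
  have ev := RLn.eventually (gt_mem_nhds (half_pos hε'))
  filter_upwards [ev] with n hn
  have lim : Tendsto (fun m : ℕ => C * ε + (ε' / 2 + C * ‖U m‖)) atTop (𝓝 (C * ε + (ε' / 2 + C * 0))) :=
    ((RLp.const_mul C).const_add _).const_add _
  have hlt : C * ε + (ε' / 2 + C * 0) < C * ε + ε' := by linarith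
  obtain ⟨m, hm, hm2⟩ := ((lim.eventually (gt_mem_nhds hlt)).and
    (eventually_ge_atTop 2)).exists
  refine le_trans ?_ hm.le
  rw [main (m + n) n (by omega)]
  have hmn : (((m + n : ℕ) : ℤ) - n) = m := by push_cast; ring
  rw [hmn]
  refine (norm_add_le _ _).trans (add_le_add ?_ ((norm_sub_le _ _).trans (add_le_add hn.le
    ((norm_mul_le _ _).trans (mul_le_mul_of_nonneg_right (hC _) (norm_nonneg _))))))
  refine (norm_sum_le _ _).trans ?_
  refine le_trans ?_ (mul_le_mul_of_nonneg_left (hε (m + n) n) hC0)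
  rw [Finset.mul_sum]
  refine Finset.sum_le_sum fun k _ => ?_
  rw [norm_smul, mul_comm]
  exact mul_le_mul_of_nonneg_right (hC _) (norm_nonneg _)

lemma ee_one_eq (v : ℝ) (hv : v ∈ Icc (-1/2 : ℝ) (1/2)) (h : ee 1 v = 1) : v = 0 := by
  unfold ee at h
  obtain ⟨n, hn⟩ := Complex.exp_eq_one_iff.1 h
  have h2 : ((-2 * Real.pi * v * (1:ℤ) : ℝ) : ℂ) = ((n * (2 * Real.pi) : ℝ) : ℂ) := by
    apply mul_right_cancel₀ Complex.I_ne_zero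
    rw [hn]; push_cast; ring
  have h3 := Complex.ofReal_injective h2
  have h4 : -v = n := by
    apply mul_right_cancel₀ (show (2 * Real.pi) ≠ 0 by positivity)
    rw [← h3]; push_cast; ring
  have h5 : (-1 : ℝ) < n := by rw [← h4]; linarith [hv.2]
  have h6 : (n : ℝ) < 1 := by rw [← h4]; linarith [hv.1]
  have : n = 0 := by
    have : -1 < n := by exact_mod_cast h5
    have : n < 1 := by exact_mod_cast h6
    omega
  subst this; simpa using h4

lemma KT (T : X →L[ℂ] X) (C : ℝ) (hC : ∀ n : ℕ, ‖T ^ n‖ ≤ C)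
    (hspec : ∀ z ∈ spectrum ℂ T, ‖z‖ = 1 → z = 1)
    (cut : ∀ ε > 0, ∃ h : ℝ → ℂ, Continuous h ∧ (∀ᶠ v in 𝓝 0, h v = 1 - ee (-1) v) ∧
      ∀ N n : ℕ, ∑ k ∈ Finset.range N, ‖∫ v in Iu, ee ((k : ℤ) - n) v * h v‖ ≤ ε) :
    Tendsto (fun n : ℕ => ‖T ^ n * (1 - T)‖) atTop (𝓝 0) := by
  have hC0 : 0 ≤ C := (norm_nonneg _).trans (hC 0)
  have unit : ∀ v ∈ Icc (-1/2 : ℝ) (1/2), v ≠ 0 → IsUnit (1 - ee 1 v • T) := by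
    intro v hv hv0
    have h1 : ee (-1) v * ee 1 v = 1 := by rw [← ee_add]; simp [ee_zero]
    have hn : ee (-1) v ∉ spectrum ℂ T := fun hm => by
      have := hspec _ hm (ee_norm _ _)
      rw [this, one_mul] at h1
      exact hv0 (ee_one_eq v hv h1)
    rw [spectrum.notMem_iff] at hn
    have h0 : IsUnit (ee 1 v) := isUnit_iff_ne_zero.2 (right_ne_zero_of_mul_eq_one h1)
    have := (h0.map (algebraMap ℂ (X →L[ℂ] X))).mul hn
    convert this using 1
    rw [mul_sub, ← map_mul, mul_comm (ee 1 v), h1, map_one, Algebra.algebraMap_eq_smul_one,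
      smul_mul_assoc, one_mul]
  rw [Metric.tendsto_atTop']
  intro ε hε
  obtain ⟨h, hc, hz, hs⟩ := cut (ε / (4 * (C + 1))) (by positivity)
  have hce := ee_cont 1
  have hcm := ee_cont (-1)
  set G : ℝ → (X →L[ℂ] X) := fun v => (1 - ee (-1) v - h v) • Ring.inverse (1 - ee 1 v • T) with hGd
  have hGc : ContinuousOn G (Icc (-1/2 : ℝ) (1/2)) := by
    intro v hv
    apply ContinuousAt.continuousWithinAt
    by_cases hv0 : v = 0
    · subst hv0
      refine ContinuousAt.congr (f := fun _ => 0) continuousAt_const ?_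
      filter_upwards [hz] with v hv
      simp [hGd, hv]
    · have c1 : ContinuousAt (fun v => 1 - ee (-1) v - h v) v := by fun_prop
      refine c1.smul ?_
      have := NormedRing.inverse_continuousAt (unit v hv hv0).unit
      refine ContinuousAt.comp (f := fun v => 1 - ee 1 v • T) (g := Ring.inverse) this ?_
      fun_prop
  have := key T C hC h hc G ((hGc.integrableOn_Icc).mono_set Ioc_subset_Icc_self) ?_ _ (ε / 4) (by positivity) hs
  · obtain ⟨n0, hn0⟩ := eventually_atTop.1 this
    refine ⟨n0, fun n hn => ?_⟩
    rw [Real.dist_0_eq_abs, abs_norm]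
    refine (hn0 n hn.le).trans_lt ?_
    have : C * (ε / (4 * (C + 1))) ≤ ε / 4 := by
      rw [mul_div_assoc', div_le_div_iff₀ (by positivity) (by positivity)]; nlinarith
    linarith
  · intro v hv
    by_cases hv0 : v = 0
    · subst hv0
      have := hz.self_of_nhds
      simp [hGd, this]
    · simp only [hGd, mul_smul_comm]
      rw [Ring.mul_inverse_cancel _ (unit v (Ioc_subset_Icc_self hv) hv0)]

lemma final (T : X →L[ℂ] X) (C : ℝ) (hC : ∀ n : ℕ, ‖T ^ n‖ ≤ C)
    (hkt : Tendsto (fun n : ℕ => ‖T ^ n * (1 - T)‖) atTop (𝓝 0))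
    (x : X) (hx : x ∈ closure (Set.range fun u : X => u - T u)) :
    Tendsto (fun n : ℕ => ‖(T ^ n) x‖) atTop (nhds 0) := by
  have hC0 : 0 ≤ C := (norm_nonneg _).trans (hC 0)
  rw [Metric.tendsto_atTop']
  intro ε hε
  obtain ⟨y, ⟨u, rfl⟩, hy⟩ := Metric.mem_closure_iff.1 hx (ε / (2 * (C + 1))) (by positivity)
  rw [dist_eq_norm] at hy
  have h1 := (hkt.mul_const ‖u‖)
  rw [zero_mul] at h1
  obtain ⟨n0, hn0⟩ := eventually_atTop.1 (h1.eventually (gt_mem_nhds (half_pos hε)))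
  refine ⟨n0, fun n hn => ?_⟩
  rw [Real.dist_0_eq_abs, abs_norm]
  have e : (T ^ n) x = (T ^ n) (x - (u - T u)) + (T ^ n * (1 - T)) u := by
    simp
  rw [e]
  have a1 := (T ^ n * (1 - T)).le_opNorm u
  have a2 := ((T ^ n).le_opNorm (x - (u - T u))).trans
    (mul_le_mul (hC n) hy.le (norm_nonneg _) hC0)
  have a3 : C * (ε / (2 * (C + 1))) ≤ ε / 2 := by
    rw [mul_div_assoc', div_le_div_iff₀ (by positivity) (by positivity)]; nlinarith
  have a4 := hn0 n hn.le
  have a5 := norm_add_le ((T ^ n) (x - (u - T u))) ((T ^ n * (1 - T)) u)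
  linarith

end aux

/-- Katznelson–Tzafriri-type consequence: if `T` is power-bounded with
`σ(T) ∩ 𝕋 ⊆ {1}` and `x` lies in the closure of `Ran(I - T)`, then
`‖Tⁿx‖ → 0`. -/
theorem tendsto_zero_of_mem_closure_range
    {X : Type*} [NormedAddCommGroup X] [NormedSpace ℂ X] [CompleteSpace X]
    (T : X →L[ℂ] X) (hpb : ∃ C : ℝ, ∀ n : ℕ, ‖T ^ n‖ ≤ C)
    (hspec : ∀ z ∈ spectrum ℂ T, ‖z‖ = 1 → z = 1)
    (x : X) (hx : x ∈ closure (Set.range fun u : X => u - T u)) :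
    Tendsto (fun n : ℕ => ‖(T ^ n) x‖) atTop (nhds 0) := by
  obtain ⟨C, hC⟩ := hpb
  exact final T C hC (KT T C hC hspec cut) x hx
end
end

section
/- For the Cesàro operator T on c and every α ∈ (0, 1/2), the operator T_α = (1−α)^{−1}(T − αI) is power-bounded, i.e. sup_{n≥0} ‖T_α^n‖ < ∞. -/
open Filter Topology

noncomputable section

/-- The space `c` of convergent complex sequences, as a subspace of the bounded
sequences (bounded continuous functions on `ℕ`), with the supremum norm. -/
def convSeqs : Submodule ℂ (BoundedContinuousFunction ℕ ℂ) where
  carrier := {x | ∃ l : ℂ, Tendsto (fun k => x k) atTop (nhds l)}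
  add_mem' := by
    rintro x y ⟨a, ha⟩ ⟨b, hb⟩
    exact ⟨a + b, by simpa using ha.add hb⟩
  zero_mem' := ⟨0, by simp⟩
  smul_mem' := by
    rintro cst x ⟨a, ha⟩
    exact ⟨cst • a, by simpa using ha.const_smul cst⟩

/-- `T` acts as the Cesàro operator. -/
def IsCesaro (T : convSeqs →L[ℂ] convSeqs) : Prop :=
  ∀ x : convSeqs, ∀ k : ℕ,
    (T x : BoundedContinuousFunction ℕ ℂ) k
      = ((k : ℂ) + 1)⁻¹ * ∑ j ∈ Finset.range (k + 1), (x : BoundedContinuousFunction ℕ ℂ) j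


namespace CesaroAux

/-- Absolutely summable coefficients. -/
def L1 (P : PowerSeries ℂ) : Prop := Summable fun k => ‖PowerSeries.coeff k P‖

/-- Evaluation of a power series in a Banach algebra. -/
def ev {A : Type*} [NormedRing A] [NormedAlgebra ℂ A] (a : A) (P : PowerSeries ℂ) : A :=
  ∑' k, PowerSeries.coeff k P • a ^ k

lemma L1.mul {P Q : PowerSeries ℂ} (hP : L1 P) (hQ : L1 Q) : L1 (P * Q) := by
  have h := summable_norm_sum_mul_antidiagonal_of_summable_norm
    (f := fun k => PowerSeries.coeff k P) (g := fun k => PowerSeries.coeff k Q) hP hQ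
  refine h.congr (fun k => ?_)
  rw [PowerSeries.coeff_mul]

lemma L1.add {P Q : PowerSeries ℂ} (hP : L1 P) (hQ : L1 Q) : L1 (P + Q) := by
  unfold L1 at *
  refine Summable.of_nonneg_of_le (fun _ => norm_nonneg _) (fun k => ?_) (Summable.add hP hQ)
  rw [map_add]
  exact norm_add_le _ _

lemma L1_C (r : ℂ) : L1 (PowerSeries.C r) := by
  unfold L1
  refine summable_of_ne_finset_zero (s := {0}) (fun k hk => ?_)
  have : k ≠ 0 := by simpa using hk
  simp [PowerSeries.coeff_C, this]

lemma L1_X : L1 (PowerSeries.X) := by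
  unfold L1
  refine summable_of_ne_finset_zero (s := {1}) (fun k hk => ?_)
  have : k ≠ 1 := by simpa using hk
  simp [PowerSeries.coeff_X, this]

lemma L1.neg {P : PowerSeries ℂ} (hP : L1 P) : L1 (-P) := by
  unfold L1 at *
  simpa using hP

lemma L1.sub {P Q : PowerSeries ℂ} (hP : L1 P) (hQ : L1 Q) : L1 (P - Q) := by
  rw [sub_eq_add_neg]
  exact hP.add hQ.neg

lemma L1.pow {P : PowerSeries ℂ} (hP : L1 P) (n : ℕ) : L1 (P ^ n) := by
  induction n with
  | zero => simpa using L1_C 1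
  | succ n ih => rw [pow_succ]; exact ih.mul hP

lemma L1_geom {q : ℝ} (h0 : 0 ≤ q) (h1 : q < 1) :
    L1 (PowerSeries.mk fun k => ((q : ℂ)) ^ k) := by
  unfold L1
  simp only [PowerSeries.coeff_mk, norm_pow, Complex.norm_real, Real.norm_eq_abs, abs_of_nonneg h0]
  exact summable_geometric_of_lt_one h0 h1

section
variable {A : Type*} [NormedRing A] [NormedAlgebra ℂ A] {a : A}

lemma summable_norm_ev (ha : ∀ k : ℕ, ‖a ^ k‖ ≤ 1)
    {P : PowerSeries ℂ} (hP : L1 P) :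
    Summable fun k => ‖PowerSeries.coeff k P • a ^ k‖ := by
  refine Summable.of_nonneg_of_le (fun _ => norm_nonneg _) (fun k => ?_) hP
  rw [norm_smul]
  exact mul_le_of_le_one_right (norm_nonneg _) (ha k)

lemma norm_ev_le (ha : ∀ k : ℕ, ‖a ^ k‖ ≤ 1)
    {P : PowerSeries ℂ} (hP : L1 P) :
    ‖ev a P‖ ≤ ∑' k, ‖PowerSeries.coeff k P‖ := by
  refine (norm_tsum_le_tsum_norm (summable_norm_ev ha hP)).trans ?_
  refine Summable.tsum_le_tsum (fun k => ?_) (summable_norm_ev ha hP) hP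
  rw [norm_smul]
  exact mul_le_of_le_one_right (norm_nonneg _) (ha k)

lemma ev_C (r : ℂ) : ev a (PowerSeries.C r) = r • (1 : A) := by
  unfold ev
  rw [tsum_eq_single 0]
  · simp
  · intro k hk
    simp [PowerSeries.coeff_C, hk]

lemma ev_X : ev a (PowerSeries.X) = a := by
  unfold ev
  rw [tsum_eq_single 1]
  · simp
  · intro k hk
    simp [PowerSeries.coeff_X, hk]

variable [CompleteSpace A]

lemma ev_mul (ha : ∀ k : ℕ, ‖a ^ k‖ ≤ 1)
    {P Q : PowerSeries ℂ} (hP : L1 P) (hQ : L1 Q) :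
    ev a (P * Q) = ev a P * ev a Q := by
  unfold ev
  rw [tsum_mul_tsum_eq_tsum_sum_antidiagonal_of_summable_norm (summable_norm_ev ha hP)
    (summable_norm_ev ha hQ)]
  congr 1
  ext k
  rw [PowerSeries.coeff_mul, Finset.sum_smul]
  refine Finset.sum_congr rfl (fun kl hkl => ?_)
  rw [smul_mul_smul_comm, ← pow_add, Finset.HasAntidiagonal.mem_antidiagonal.1 hkl]

lemma ev_add (ha : ∀ k : ℕ, ‖a ^ k‖ ≤ 1)
    {P Q : PowerSeries ℂ} (hP : L1 P) (hQ : L1 Q) :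
    ev a (P + Q) = ev a P + ev a Q := by
  unfold ev
  rw [← Summable.tsum_add (summable_norm_ev ha hP).of_norm (summable_norm_ev ha hQ).of_norm]
  simp only [map_add, add_smul]

lemma ev_sub (ha : ∀ k : ℕ, ‖a ^ k‖ ≤ 1)
    {P Q : PowerSeries ℂ} (hP : L1 P) (hQ : L1 Q) :
    ev a (P - Q) = ev a P - ev a Q := by
  have := ev_add ha (hP.sub hQ) hQ
  rw [sub_add_cancel] at this
  rw [this, add_sub_cancel_right]

lemma ev_pow (ha : ∀ k : ℕ, ‖a ^ k‖ ≤ 1)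
    {P : PowerSeries ℂ} (hP : L1 P) (n : ℕ) :
    ev a (P ^ n) = ev a P ^ n := by
  induction n with
  | zero => simpa using ev_C (a := a) 1
  | succ n ih => rw [pow_succ, ev_mul ha (hP.pow n) hP, ih, pow_succ]

end

lemma norm_exp_pow (θ : ℝ) (k : ℕ) : ‖Complex.exp (θ * Complex.I) ^ k‖ ≤ 1 := by
  rw [norm_pow, Complex.norm_exp_ofReal_mul_I, one_pow]

lemma continuous_ev {P : PowerSeries ℂ} (hP : L1 P) :
    Continuous fun θ : ℝ => ev (Complex.exp (θ * Complex.I)) P := by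
  unfold ev
  refine continuous_tsum (u := fun k => ‖PowerSeries.coeff k P‖) (fun k => by fun_prop) hP ?_
  intro k θ
  rw [norm_smul]
  exact mul_le_of_le_one_right (norm_nonneg _) (norm_exp_pow θ k)

lemma parseval {P : PowerSeries ℂ} (hP : L1 P) (M : ℕ) :
    ∑ k ∈ Finset.range M, ‖PowerSeries.coeff k P‖ ^ 2 ≤
      (2 * Real.pi)⁻¹ * ∫ θ in (-Real.pi)..Real.pi, ‖ev (Complex.exp (θ * Complex.I)) P‖ ^ 2 := by
  have hper : ∫ θ in (-Real.pi)..Real.pi, ‖ev (Complex.exp (θ * Complex.I)) P‖ ^ 2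
      = ∫ θ in (0 : ℝ)..(2 * Real.pi), ‖ev (Complex.exp (θ * Complex.I)) P‖ ^ 2 := by
    have hp : Function.Periodic
        (fun θ : ℝ => ‖ev (Complex.exp (θ * Complex.I)) P‖ ^ 2) (2 * Real.pi) := by
      intro θ
      have : Complex.exp (((θ + 2 * Real.pi : ℝ) : ℂ) * Complex.I)
          = Complex.exp (θ * Complex.I) := by
        push_cast
        rw [add_mul, Complex.exp_periodic]
      simp only [this]
    have := hp.intervalIntegral_add_eq (-Real.pi) 0
    rw [show -Real.pi + 2 * Real.pi = Real.pi by ring, zero_add] at this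
    exact this
  rw [hper]
  have hpoly : ∀ N : ℕ, ∑ k ∈ Finset.range N, ‖PowerSeries.coeff k P‖ ^ 2
      = (2 * Real.pi)⁻¹ * ∫ θ in (0 : ℝ)..(2 * Real.pi),
        ‖∑ k ∈ Finset.range N, PowerSeries.coeff k P • Complex.exp (θ * Complex.I) ^ k‖ ^ 2 := by
    intro N
    have h := Polynomial.sum_sq_norm_coeff_eq_circleAverage (PowerSeries.trunc N P)
    rw [Real.circleAverage_def] at h
    have h1 : ∑ i ∈ (PowerSeries.trunc N P).support, ‖(PowerSeries.trunc N P).coeff i‖ ^ 2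
        = ∑ k ∈ Finset.range N, ‖PowerSeries.coeff k P‖ ^ 2 := by
      rw [Finset.sum_subset (s₂ := Finset.range N)]
      · refine Finset.sum_congr rfl (fun k hk => ?_)
        rw [PowerSeries.coeff_trunc, if_pos (Finset.mem_range.1 hk)]
      · intro k hk
        rw [Polynomial.mem_support_iff, PowerSeries.coeff_trunc] at hk
        by_contra h2
        rw [Finset.mem_range] at h2
        simp [h2] at hk
      · intro k _ hk
        rw [Polynomial.notMem_support_iff] at hk
        simp [hk]
    rw [← h1, h, smul_eq_mul]
    congr 2
    ext θ
    rw [Polynomial.eval_eq_sum_range' (n := N + 1)]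
    · rw [Finset.sum_range_succ, PowerSeries.coeff_trunc, if_neg (lt_irrefl _), zero_mul, add_zero]
      congr 2
      refine Finset.sum_congr rfl (fun k hk => ?_)
      rw [PowerSeries.coeff_trunc, if_pos (Finset.mem_range.1 hk)]
      simp [circleMap]
    · have := PowerSeries.natDegree_trunc_lt P
      rcases N with _ | N
      · simp
      · exact (this N).trans (Nat.lt_succ_self _)
  have hlim : Tendsto (fun N : ℕ => ∫ θ in (0 : ℝ)..(2 * Real.pi),
        ‖∑ k ∈ Finset.range N, PowerSeries.coeff k P • Complex.exp (θ * Complex.I) ^ k‖ ^ 2) atTop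
      (nhds (∫ θ in (0 : ℝ)..(2 * Real.pi), ‖ev (Complex.exp (θ * Complex.I)) P‖ ^ 2)) := by
    refine intervalIntegral.tendsto_integral_filter_of_dominated_convergence
      (fun _ => (∑' k, ‖PowerSeries.coeff k P‖) ^ 2) ?_ ?_ ?_ ?_
    · refine Eventually.of_forall (fun N => ?_)
      exact Continuous.aestronglyMeasurable (by fun_prop)
    · refine Eventually.of_forall (fun N => Eventually.of_forall (fun θ _ => ?_))
      rw [norm_pow, norm_norm]
      gcongr
      refine (norm_sum_le _ _).trans (le_trans ?_ (hP.sum_le_tsum (Finset.range N)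
        (fun _ _ => norm_nonneg _)))
      refine Finset.sum_le_sum (fun k _ => ?_)
      rw [norm_smul]
      exact mul_le_of_le_one_right (norm_nonneg _) (norm_exp_pow θ k)
    · exact intervalIntegrable_const
    · refine Eventually.of_forall (fun θ _ => ?_)
      exact ((summable_norm_ev (norm_exp_pow θ) hP).of_norm.hasSum.tendsto_sum_nat.norm).pow 2
  refine ge_of_tendsto (hlim.const_mul ((2 * Real.pi)⁻¹)) ?_
  filter_upwards [eventually_ge_atTop M] with N hN
  rw [← hpoly N]
  exact Finset.sum_le_sum_of_subset_of_nonneg (Finset.range_mono hN) (fun _ _ _ => by positivity)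

/-- A bounded increasing comparison function. -/
def phi (s x : ℝ) : ℝ := x / (s + |x|)

lemma phi_step {s : ℝ} (hs : 1 ≤ s) (x : ℝ) :
    s ^ 2 / (s ^ 2 + x ^ 2) ≤ 8 * s * (phi s (x + 1) - phi s x) := by
  have h1 : s / (s + |x| + 1) ^ 2 ≤ phi s (x + 1) - phi s x := by
    unfold phi
    rcases le_total 0 x with hx | hx
    · rw [abs_of_nonneg hx, abs_of_nonneg (by linarith : 0 ≤ x + 1)]
      rw [div_sub_div _ _ (by positivity) (by positivity), div_le_div_iff₀ (by positivity)
        (by positivity)]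
      have : (x + 1) * (s + x) - (s + (x + 1)) * x = s := by ring
      rw [this]
      have : s * ((s + (x + 1)) * (s + x)) ≤ s * (s + x + 1) ^ 2 := by
        apply mul_le_mul_of_nonneg_left _ (by linarith)
        nlinarith
      exact this
    · rcases le_total (x + 1) 0 with hx1 | hx1
      · rw [abs_of_nonpos hx, abs_of_nonpos hx1]
        have p1 : 0 < s + -(x + 1) := by linarith
        have p2 : 0 < s + -x := by linarith
        rw [div_sub_div _ _ (by positivity) (by positivity), div_le_div_iff₀ (by positivity)
          (by positivity)]
        have : (x + 1) * (s + -x) - (s + -(x + 1)) * x = s := by ring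
        rw [this]
        apply mul_le_mul_of_nonneg_left _ (by linarith)
        nlinarith
      · rw [abs_of_nonpos hx, abs_of_nonneg hx1]
        have p1 : 0 < s + (x + 1) := by linarith
        have p2 : 0 < s + -x := by linarith
        have e1 : (x + 1) / (s + 1) ≤ (x + 1) / (s + (x + 1)) := by
          apply div_le_div_of_nonneg_left hx1 p1; linarith
        have e2 : (-x) / (s + 1) ≤ (-x) / (s + -x) := by
          apply div_le_div_of_nonneg_left (by linarith) p2; linarith
        have e3 : s / (s + -x + 1) ^ 2 ≤ 1 / (s + 1) := by
          rw [div_le_div_iff₀ (by positivity) (by positivity)]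
          nlinarith
        have e4 : 1 / (s + 1) = (x + 1) / (s + 1) + (-x) / (s + 1) := by
          rw [← add_div]; congr 1; ring
        have e5 : (-x) / (s + -x) = -(x / (s + -x)) := by rw [neg_div]
        linarith
  have h2 : s ^ 2 / (s ^ 2 + x ^ 2) ≤ 8 * s * (s / (s + |x| + 1) ^ 2) := by
    rw [mul_div_assoc', div_le_div_iff₀ (by positivity) (by positivity), ← sq_abs x]
    have hy := abs_nonneg x
    set y := |x|
    have : (s + y + 1) ^ 2 ≤ 8 * (s ^ 2 + y ^ 2) := by nlinarith [sq_nonneg (2 * s - 2 * y)]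
    have hs2 : 0 ≤ s ^ 2 := by positivity
    nlinarith [mul_le_mul_of_nonneg_left this hs2]
  refine h2.trans ?_
  exact mul_le_mul_of_nonneg_left h1 (by linarith)

lemma phi_abs {s : ℝ} (hs : 1 ≤ s) (x : ℝ) : |phi s x| ≤ 1 := by
  unfold phi
  have := abs_nonneg x
  rw [abs_div, abs_of_pos (by linarith : 0 < s + |x|), div_le_one (by linarith)]
  linarith

lemma sum_weight {s : ℝ} (hs : 1 ≤ s) (μ : ℝ) (M : ℕ) :
    ∑ k ∈ Finset.range M, s ^ 2 / (s ^ 2 + ((k : ℝ) - μ) ^ 2) ≤ 16 * s := by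
  have h : ∑ k ∈ Finset.range M, s ^ 2 / (s ^ 2 + ((k : ℝ) - μ) ^ 2)
      ≤ 8 * s * (phi s ((M : ℝ) - μ) - phi s (0 - μ)) := by
    induction M with
    | zero => simp
    | succ M ih =>
      rw [Finset.sum_range_succ]
      have := phi_step hs ((M : ℝ) - μ)
      rw [show ((M : ℝ) - μ) + 1 = ((M + 1 : ℕ) : ℝ) - μ by push_cast; ring] at this
      linarith
  have h1 := abs_le.1 (phi_abs hs ((M : ℝ) - μ))
  have h2 := abs_le.1 (phi_abs hs (0 - μ))
  nlinarith

lemma gauss {b : ℝ} (hb : 0 < b) :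
    ∫ θ in (-Real.pi)..Real.pi, Real.exp (-b * θ ^ 2) ≤ √(Real.pi / b) := by
  rw [← integral_gaussian, intervalIntegral.integral_of_le (by linarith [Real.pi_pos])]
  exact MeasureTheory.setIntegral_le_integral (integrable_exp_neg_mul_sq hb)
    (Eventually.of_forall fun _ => (Real.exp_pos _).le)

/-- Abstract bound: power series with Gaussian bounds on the circle. -/
lemma abstract_bound {F H : PowerSeries ℂ} (hF : L1 F) (hH : L1 H) {a δ K : ℝ} (hδ : 0 < δ)
    (hK : 0 ≤ K)
    (hD : PowerSeries.X * PowerSeries.derivative ℂ F - PowerSeries.C (a : ℂ) * F = H)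
    (hFb : ∀ θ ∈ Set.Icc (-Real.pi) Real.pi,
      ‖ev (Complex.exp (θ * Complex.I)) F‖ ^ 2 ≤ Real.exp (-δ * θ ^ 2))
    (hHb : ∀ θ ∈ Set.Icc (-Real.pi) Real.pi,
      ‖ev (Complex.exp (θ * Complex.I)) H‖ ^ 2 ≤ K * θ ^ 2) :
    ∃ C : ℝ, ∀ n : ℕ, ∑' k, ‖PowerSeries.coeff k (F ^ n)‖ ≤ C := by
  have hpi := Real.pi_pos
  set B0 : ℝ := (2 * Real.pi)⁻¹ * √(Real.pi / δ) with hB0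
  set E : ℝ := K * Real.exp (δ * Real.pi ^ 2) * (2 / δ) with hE
  set B1 : ℝ := (2 * Real.pi)⁻¹ * (E * √(Real.pi / (δ / 2))) with hB1
  refine ⟨1 + √(16 * (B0 + B1)), fun n => ?_⟩
  have hsq0 : 0 ≤ √(16 * (B0 + B1)) := Real.sqrt_nonneg _
  rcases Nat.eq_zero_or_pos n with rfl | hn
  · rw [pow_zero, tsum_eq_single 0]
    · simp
    · intro k hk
      simp [PowerSeries.coeff_one, hk]
  have hn1 : (1 : ℝ) ≤ n := by exact_mod_cast hn
  have hn0 : (0 : ℝ) < n := by linarith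
  have hs1 : 1 ≤ √(n : ℝ) := by rw [Real.one_le_sqrt]; exact hn1
  have hsq : √(n : ℝ) ^ 2 = n := Real.sq_sqrt hn0.le
  -- the differentiated series
  have hQ : PowerSeries.X * PowerSeries.derivative ℂ (F ^ n)
      - PowerSeries.C ((n : ℂ) * a) * F ^ n = PowerSeries.C (n : ℂ) * (F ^ (n - 1) * H) := by
    obtain ⟨m, rfl⟩ : ∃ m, n = m + 1 := ⟨n - 1, by omega⟩
    rw [PowerSeries.derivative_pow, ← hD]
    simp only [Nat.add_sub_cancel, map_mul, map_natCast]
    ring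
  have hcoeff : ∀ k, PowerSeries.coeff k (PowerSeries.C (n : ℂ) * (F ^ (n - 1) * H))
      = ((k : ℂ) - n * a) * PowerSeries.coeff k (F ^ n) := by
    intro k
    rw [← hQ, map_sub, PowerSeries.coeff_C_mul]
    rcases k with _ | k
    · simp
    · rw [PowerSeries.coeff_succ_X_mul, PowerSeries.coeff_derivative]
      push_cast
      ring
  have hS0 : ∀ M, ∑ k ∈ Finset.range M, ‖PowerSeries.coeff k (F ^ n)‖ ^ 2 ≤ B0 / √(n : ℝ) := by
    intro M
    refine (parseval (hF.pow n) M).trans ?_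
    rw [hB0, mul_div_assoc]
    refine mul_le_mul_of_nonneg_left ?_ (by positivity)
    rw [← Real.sqrt_div (by positivity), div_div]
    refine le_trans ?_ (gauss (by positivity))
    refine intervalIntegral.integral_mono_on (by linarith) ?_ ?_ ?_
    · exact ((continuous_ev (hF.pow n)).norm.pow 2).intervalIntegrable _ _
    · exact Continuous.intervalIntegrable (by fun_prop) _ _
    · intro θ hθ
      rw [ev_pow (norm_exp_pow θ) hF, norm_pow, ← pow_mul, mul_comm n 2, pow_mul]
      refine (pow_le_pow_left₀ (by positivity) (hFb θ hθ) n).trans (le_of_eq ?_)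
      rw [← Real.exp_nat_mul]
      congr 1
      ring
  have hS1 : ∀ M, ∑ k ∈ Finset.range M,
      (((k : ℝ) - n * a) ^ 2 * ‖PowerSeries.coeff k (F ^ n)‖ ^ 2) ≤ n * (B1 / √(n : ℝ)) := by
    intro M
    have hL : L1 (PowerSeries.C (n : ℂ) * (F ^ (n - 1) * H)) :=
      (L1_C _).mul ((hF.pow _).mul hH)
    have hpars := parseval hL M
    have hleft : ∑ k ∈ Finset.range M,
        ‖PowerSeries.coeff k (PowerSeries.C (n : ℂ) * (F ^ (n - 1) * H))‖ ^ 2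
        = ∑ k ∈ Finset.range M,
      (((k : ℝ) - n * a) ^ 2 * ‖PowerSeries.coeff k (F ^ n)‖ ^ 2) := by
      refine Finset.sum_congr rfl (fun k _ => ?_)
      rw [hcoeff, norm_mul, mul_pow]
      congr 1
      have : ((k : ℂ) - n * a) = (((k : ℝ) - n * a : ℝ) : ℂ) := by push_cast; ring
      rw [this, Complex.norm_real, Real.norm_eq_abs, sq_abs]
    rw [hleft] at hpars
    refine hpars.trans ?_
    have hrhs : n * (B1 / √(n : ℝ))
        = (2 * Real.pi)⁻¹ * (n * E * √(Real.pi / (n * (δ / 2)))) := by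
      rw [hB1, mul_comm (n : ℝ) (δ / 2), ← div_div Real.pi (δ / 2) n,
        Real.sqrt_div (by positivity : 0 ≤ Real.pi / (δ / 2)) n]
      ring
    rw [hrhs]
    refine mul_le_mul_of_nonneg_left ?_ (by positivity)
    have hE0 : 0 ≤ E := by positivity
    refine le_trans ?_ (mul_le_mul_of_nonneg_left
      (gauss (b := n * (δ / 2)) (by positivity)) (by positivity))
    rw [← intervalIntegral.integral_const_mul]
    refine intervalIntegral.integral_mono_on (by linarith) ?_ ?_ ?_
    · exact ((continuous_ev hL).norm.pow 2).intervalIntegrable _ _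
    · exact Continuous.intervalIntegrable (by fun_prop) _ _
    · intro θ hθ
      have hw := norm_exp_pow θ
      rw [ev_mul hw (L1_C _) ((hF.pow _).mul hH), ev_mul hw (hF.pow _) hH, ev_pow hw hF, ev_C,
        norm_mul, norm_mul, norm_smul, norm_one, mul_one, Complex.norm_natCast, norm_pow,
        mul_pow, mul_pow, ← pow_mul, mul_comm (n - 1) 2, pow_mul]
      have h1 : (‖ev (Complex.exp (θ * Complex.I)) F‖ ^ 2) ^ (n - 1)
          ≤ Real.exp (δ * Real.pi ^ 2) * Real.exp (-(δ * n) * θ ^ 2) := by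
        refine (pow_le_pow_left₀ (by positivity) (hFb θ hθ) _).trans ?_
        rw [← Real.exp_nat_mul, ← Real.exp_add, Real.exp_le_exp, Nat.cast_sub hn]
        have : θ ^ 2 ≤ Real.pi ^ 2 := sq_le_sq' hθ.1 hθ.2
        push_cast
        nlinarith
      have h2 : θ ^ 2 * Real.exp (-(δ * n) * θ ^ 2)
          ≤ 2 / (δ * n) * Real.exp (-(n * (δ / 2)) * θ ^ 2) := by
        have e : Real.exp (-(δ * n) * θ ^ 2)
            = Real.exp (-(n * (δ / 2) * θ ^ 2)) * Real.exp (-(n * (δ / 2)) * θ ^ 2) := by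
          rw [← Real.exp_add]; congr 1; ring
        rw [e, ← mul_assoc]
        refine mul_le_mul_of_nonneg_right ?_ (Real.exp_pos _).le
        rw [Real.exp_neg, ← div_eq_mul_inv, div_le_div_iff₀ (Real.exp_pos _) (by positivity)]
        have := Real.add_one_le_exp (n * (δ / 2) * θ ^ 2)
        nlinarith
      calc (n : ℝ) ^ 2 * ((‖ev (Complex.exp (θ * Complex.I)) F‖ ^ 2) ^ (n - 1)
              * ‖ev (Complex.exp (θ * Complex.I)) H‖ ^ 2)
          ≤ (n : ℝ) ^ 2 * ((Real.exp (δ * Real.pi ^ 2) * Real.exp (-(δ * n) * θ ^ 2))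
              * (K * θ ^ 2)) := by
            gcongr
            exact hHb θ hθ
        _ = (n : ℝ) ^ 2 * K * Real.exp (δ * Real.pi ^ 2)
              * (θ ^ 2 * Real.exp (-(δ * n) * θ ^ 2)) := by ring
        _ ≤ (n : ℝ) ^ 2 * K * Real.exp (δ * Real.pi ^ 2)
              * (2 / (δ * n) * Real.exp (-(n * (δ / 2)) * θ ^ 2)) := by gcongr
        _ = n * E * Real.exp (-(n * (δ / 2)) * θ ^ 2) := by
            rw [hE]; field_simp
  refine (L1.pow hF n).tsum_le_of_sum_range_le (fun M => ?_) |>.trans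
    (by linarith : √(16 * (B0 + B1)) ≤ _)
  refine Real.le_sqrt_of_sq_le ?_
  have hCS := Finset.sum_sq_le_sum_mul_sum_of_sq_le_mul (Finset.range M)
    (r := fun k => ‖PowerSeries.coeff k (F ^ n)‖)
    (f := fun k : ℕ => √(n : ℝ) ^ 2 / (√(n : ℝ) ^ 2 + ((k : ℝ) - n * a) ^ 2))
    (g := fun k => ‖PowerSeries.coeff k (F ^ n)‖ ^ 2
      + (((k : ℝ) - n * a) ^ 2 * ‖PowerSeries.coeff k (F ^ n)‖ ^ 2) / n)
    (fun k _ => by positivity) (fun k _ => by positivity)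
    (fun k _ => le_of_eq <| by
      rw [hsq]
      have : (n : ℝ) + ((k : ℝ) - n * a) ^ 2 ≠ 0 := by positivity
      field_simp)
  refine hCS.trans ?_
  have hg : ∑ k ∈ Finset.range M, (‖PowerSeries.coeff k (F ^ n)‖ ^ 2
      + (((k : ℝ) - n * a) ^ 2 * ‖PowerSeries.coeff k (F ^ n)‖ ^ 2) / n)
      ≤ (B0 + B1) / √(n : ℝ) := by
    rw [Finset.sum_add_distrib, ← Finset.sum_div, add_div]
    refine add_le_add (hS0 M) ?_
    rw [div_le_iff₀ hn0, mul_comm _ (n : ℝ)]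
    exact hS1 M
  refine (mul_le_mul (sum_weight hs1 (n * a) M) hg (Finset.sum_nonneg fun k _ => by positivity)
    (by positivity)).trans (le_of_eq ?_)
  have : √(n : ℝ) ≠ 0 := by positivity
  field_simp

/-- Geometric series. -/
def G (q : ℝ) : PowerSeries ℂ := PowerSeries.mk fun k => ((q : ℂ)) ^ k

lemma G_mul (q : ℝ) : (1 - PowerSeries.C (q : ℂ) * PowerSeries.X) * G q = 1 := by
  ext k
  rw [sub_mul, one_mul, mul_assoc, map_sub, PowerSeries.coeff_C_mul]
  rcases k with _ | k
  · simp [G]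
  · rw [PowerSeries.coeff_succ_X_mul]
    simp [G, PowerSeries.coeff_one, pow_succ, mul_comm]

/-- The symbol of the shifted operator. -/
def F (β q : ℝ) : PowerSeries ℂ :=
  (PowerSeries.C ((1 - q + β : ℝ) : ℂ) * PowerSeries.X - PowerSeries.C (β : ℂ)) * G q

/-- The centred logarithmic-type derivative. -/
def H (β q : ℝ) : PowerSeries ℂ :=
  PowerSeries.C (((1 + β) / (1 - q) : ℝ) : ℂ) * ((PowerSeries.C 1 - PowerSeries.X) *
    ((PowerSeries.C (β : ℂ) - PowerSeries.C (((1 - q + β) * q : ℝ) : ℂ) * PowerSeries.X)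
      * (G q * G q)))

lemma deriv_G (q : ℝ) : PowerSeries.derivative ℂ (G q) = PowerSeries.C (q : ℂ) * (G q * G q) := by
  have h := congrArg (PowerSeries.derivative ℂ) (G_mul q)
  have h2 := G_mul q
  simp only [Derivation.leibniz, map_sub, PowerSeries.derivative_one, PowerSeries.derivative_C,
    PowerSeries.derivative_X, smul_eq_mul] at h
  linear_combination G q * h - PowerSeries.derivative ℂ (G q) * h2

lemma F_deriv {β q : ℝ} (hq : q < 1) :
    PowerSeries.X * PowerSeries.derivative ℂ (F β q)
      - PowerSeries.C (((1 + β) / (1 - q) : ℝ) : ℂ) * F β q = H β q := by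
  have h2 := G_mul q
  set a : ℝ := (1 + β) / (1 - q) with ha
  have hc : a * (1 - q) = 1 + β := by
    rw [ha]; exact div_mul_cancel₀ _ (by linarith)
  have hca : PowerSeries.C (a : ℂ) * (1 - PowerSeries.C (q : ℂ))
      = 1 + PowerSeries.C (β : ℂ) := by
    rw [← map_one (PowerSeries.C (R := ℂ)), ← map_sub, ← map_mul, ← map_add]
    congr 1
    exact_mod_cast hc
  unfold F H
  simp only [Derivation.leibniz, map_sub, PowerSeries.derivative_C,
    PowerSeries.derivative_X, PowerSeries.derivative_one, smul_eq_mul, deriv_G, Complex.ofReal_add, Complex.ofReal_sub,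
    Complex.ofReal_mul, Complex.ofReal_one, map_add, map_mul, map_one]
  rw [← ha]
  set A := PowerSeries.C (a : ℂ)
  set Q := PowerSeries.C (q : ℂ)
  set b := PowerSeries.C (β : ℂ)
  set X := (PowerSeries.X : PowerSeries ℂ)
  set g := G q
  -- multiply the degree one terms by `(1 - Q X) g = 1`
  have e1 : g = (1 - Q * X) * (g * g) := by linear_combination -g * h2
  have e2 : (1 - Q + b) * g = ((1 - Q + b) * (1 - Q * X)) * (g * g) := by
    rw [mul_assoc, ← e1]
  have e3 : ((1 - Q + b) * X - b) * g = (((1 - Q + b) * X - b) * (1 - Q * X)) * (g * g) := by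
    rw [mul_assoc, ← e1]
  linear_combination (X * (1 - Q + b) - A * ((1 - Q + b) * X - b)) * e1
    - X * (g * g) * (1 - Q) * hca

lemma L1_G {q : ℝ} (h0 : 0 ≤ q) (h1 : q < 1) : L1 (G q) := L1_geom h0 h1

lemma L1_F {β q : ℝ} (h0 : 0 ≤ q) (h1 : q < 1) : L1 (F β q) :=
  (((L1_C _).mul L1_X).sub (L1_C _)).mul (L1_G h0 h1)

lemma L1_H {β q : ℝ} (h0 : 0 ≤ q) (h1 : q < 1) : L1 (H β q) :=
  (L1_C _).mul (((L1_C _).sub L1_X).mul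
    (((L1_C _).sub ((L1_C _).mul L1_X)).mul ((L1_G h0 h1).mul (L1_G h0 h1))))

lemma norm_lin (u v θ : ℝ) :
    ‖(u : ℂ) - v * Complex.exp (θ * Complex.I)‖ ^ 2 = u ^ 2 + v ^ 2 - 2 * u * v * Real.cos θ := by
  rw [← Complex.normSq_eq_norm_sq, Complex.exp_mul_I, ← Complex.ofReal_cos, ← Complex.ofReal_sin,
    Complex.normSq_apply]
  simp only [Complex.sub_re, Complex.sub_im, Complex.mul_re, Complex.mul_im, Complex.add_re,
    Complex.add_im, Complex.ofReal_re, Complex.ofReal_im, Complex.I_re, Complex.I_im]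
  linear_combination v ^ 2 * Real.sin_sq_add_cos_sq θ

section
variable {A : Type*} [NormedRing A] [NormedAlgebra ℂ A] [CompleteSpace A] {a : A}

lemma ev_G (ha : ∀ k : ℕ, ‖a ^ k‖ ≤ 1) {q : ℝ} (h0 : 0 ≤ q) (h1 : q < 1) :
    ev a (G q) * (1 - (q : ℂ) • a) = 1 := by
  have h := congrArg (ev a) (G_mul q)
  rw [← map_one (PowerSeries.C (R := ℂ)), mul_comm, ev_mul ha (L1_G h0 h1)
    ((L1_C 1).sub ((L1_C _).mul L1_X)), ev_sub ha (L1_C 1) ((L1_C _).mul L1_X),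
    ev_mul ha (L1_C _) L1_X, ev_C, ev_C, ev_X, one_smul, smul_mul_assoc, one_mul] at h
  exact h

lemma ev_F (ha : ∀ k : ℕ, ‖a ^ k‖ ≤ 1) {β q : ℝ} (h0 : 0 ≤ q) (h1 : q < 1) :
    ev a (F β q) = (((1 - q + β : ℝ) : ℂ) • a - (β : ℂ) • 1) * ev a (G q) := by
  unfold F
  rw [ev_mul ha (((L1_C _).mul L1_X).sub (L1_C _)) (L1_G h0 h1),
    ev_sub ha ((L1_C _).mul L1_X) (L1_C _), ev_mul ha (L1_C _) L1_X, ev_C, ev_C, ev_X,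
    smul_mul_assoc, one_mul]

lemma ev_H (ha : ∀ k : ℕ, ‖a ^ k‖ ≤ 1) {β q : ℝ} (h0 : 0 ≤ q) (h1 : q < 1) :
    ev a (H β q) = (((1 + β) / (1 - q) : ℝ) : ℂ) • ((1 - a) *
      (((β : ℂ) • 1 - (((1 - q + β) * q : ℝ) : ℂ) • a) * (ev a (G q) * ev a (G q)))) := by
  unfold H
  have hGG := (L1_G h0 h1).mul (L1_G h0 h1)
  have hl := (L1_C (β : ℂ)).sub ((L1_C (((1 - q + β) * q : ℝ) : ℂ)).mul L1_X)
  have h1X := (L1_C 1).sub L1_X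
  rw [ev_mul ha (L1_C _) (h1X.mul (hl.mul hGG)), ev_mul ha h1X (hl.mul hGG), ev_mul ha hl hGG,
    ev_mul ha (L1_G h0 h1) (L1_G h0 h1), ev_sub ha (L1_C _) L1_X,
    ev_sub ha (L1_C _) ((L1_C _).mul L1_X), ev_mul ha (L1_C _) L1_X, ev_C, ev_C, ev_C, ev_C, ev_X,
    smul_mul_assoc, one_mul, smul_mul_assoc, one_mul, one_smul]

end

lemma coeff_bound {β q : ℝ} (hβ : 0 < β) (hβq : β < q) (hq : q < 1) :
    ∃ C : ℝ, ∀ n : ℕ, ∑' k, ‖PowerSeries.coeff k (F β q ^ n)‖ ≤ C := by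
  have h0 : 0 ≤ q := by linarith
  have hpi := Real.pi_pos
  have hqb : 0 < q - β := by linarith
  have hq1 : 0 < 1 - q := by linarith
  set κ : ℝ := 2 * ((q - β) * (1 + β)) / (1 + q) ^ 2 with hκ
  have hκ0 : 0 < κ := by positivity
  have hgn : ∀ θ : ℝ, ‖ev (Complex.exp (θ * Complex.I)) (G q)‖ ^ 2
      * (1 + q ^ 2 - 2 * q * Real.cos θ) = 1 := by
    intro θ
    have h := congrArg (fun z : ℂ => ‖z‖ ^ 2) (ev_G (norm_exp_pow θ) h0 hq)
    have hl := norm_lin 1 q θ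
    simp only [norm_mul, mul_pow, smul_eq_mul, norm_one, one_pow] at h
    rw [Complex.ofReal_one] at hl
    rw [hl] at h
    linear_combination h
  refine abstract_bound (L1_F h0 hq) (L1_H h0 hq) (a := (1 + β) / (1 - q))
    (δ := κ * (2 / Real.pi ^ 2))
    (K := ((1 + β) / (1 - q)) ^ 2 * ((β + (1 - q + β) * q) ^ 2 * (((1 - q) ^ 2)⁻¹) ^ 2))
    (by positivity) (by positivity) (F_deriv hq) ?_ ?_
  · intro θ hθ
    have hcos := Real.cos_le_one_sub_mul_cos_sq (abs_le.2 hθ)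
    have hg := hgn θ
    have hl := norm_lin β (1 - q + β) θ
    rw [ev_F (norm_exp_pow θ) h0 hq, norm_mul, mul_pow, smul_eq_mul, smul_eq_mul, mul_one,
      norm_sub_rev, hl]
    set x := Real.cos θ
    set g := ‖ev (Complex.exp (θ * Complex.I)) (G q)‖ ^ 2
    have hx1 : -1 ≤ x := Real.neg_one_le_cos θ
    have hx2 : x ≤ 1 := Real.cos_le_one θ
    have hg0 : 0 ≤ g := by positivity
    have hgl : ((1 + q) ^ 2)⁻¹ ≤ g := by
      rw [inv_le_iff_one_le_mul₀ (by positivity), ← hg]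
      apply mul_le_mul_of_nonneg_left _ hg0
      nlinarith
    have e : (β ^ 2 + (1 - q + β) ^ 2 - 2 * β * (1 - q + β) * x) * g
        = 1 - 2 * ((q - β) * (1 + β)) * (1 - x) * g := by
      linear_combination hg
    have e2 : κ * (1 - x) ≤ 2 * ((q - β) * (1 + β)) * (1 - x) * g := by
      rw [hκ, div_eq_mul_inv, mul_right_comm]
      apply mul_le_mul_of_nonneg_left hgl
      have : 0 ≤ 1 - x := by linarith
      positivity
    have e3 : κ * (2 / Real.pi ^ 2) * θ ^ 2 ≤ κ * (1 - x) := by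
      rw [mul_assoc]
      apply mul_le_mul_of_nonneg_left _ hκ0.le
      linarith
    have := Real.add_one_le_exp (-(κ * (2 / Real.pi ^ 2)) * θ ^ 2)
    linarith
  · intro θ hθ
    have hg := hgn θ
    have hl1 := norm_lin 1 1 θ
    have hl := norm_lin β ((1 - q + β) * q) θ
    have hcos := Real.one_sub_sq_div_two_le_cos (x := θ)
    rw [ev_H (norm_exp_pow θ) h0 hq]
    simp only [norm_mul, mul_pow, smul_eq_mul, mul_one, hl, Complex.norm_real,
      Real.norm_eq_abs, sq_abs]
    rw [Complex.ofReal_one, one_mul] at hl1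
    rw [hl1]
    set x := Real.cos θ
    set g := ‖ev (Complex.exp (θ * Complex.I)) (G q)‖ ^ 2
    have hx1 : -1 ≤ x := Real.neg_one_le_cos θ
    have hx2 : x ≤ 1 := Real.cos_le_one θ
    have hg0 : 0 ≤ g := by positivity
    have hgu : g ≤ ((1 - q) ^ 2)⁻¹ := by
      rw [← one_div, le_div_iff₀ (by positivity), ← hg]
      apply mul_le_mul_of_nonneg_left _ hg0
      nlinarith
    have f1 : 1 ^ 2 + 1 ^ 2 - 2 * 1 * 1 * x ≤ θ ^ 2 := by linarith
    have hbq : 0 ≤ β * ((1 - q + β) * q) := by positivity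
    have f2 : β ^ 2 + (1 - q + β) ^ 2 * q ^ 2 - 2 * β * ((1 - q + β) * q) * x
        ≤ (β + (1 - q + β) * q) ^ 2 := by nlinarith
    have f3 : g * g ≤ ((1 - q) ^ 2)⁻¹ ^ 2 := by
      rw [sq]
      exact mul_le_mul hgu hgu hg0 (by positivity)
    have f20 : 0 ≤ β ^ 2 + (1 - q + β) ^ 2 * q ^ 2 - 2 * β * ((1 - q + β) * q) * x := by
      nlinarith [sq_nonneg (β - (1 - q + β) * q)]
    rw [mul_assoc (((1 + β) / (1 - q)) ^ 2) _ (θ ^ 2),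
      mul_comm ((β + (1 - q + β) * q) ^ 2 * ((1 - q) ^ 2)⁻¹ ^ 2) (θ ^ 2)]
    refine mul_le_mul_of_nonneg_left ?_ (sq_nonneg _)
    refine mul_le_mul f1 ?_ (mul_nonneg f20 (mul_nonneg hg0 hg0)) (sq_nonneg _)
    exact mul_le_mul f2 f3 (mul_nonneg hg0 hg0) (sq_nonneg _)

/-- The resolvent recursion. -/
def wseq (c : ℝ) (y : ℕ → ℂ) : ℕ → ℂ
  | 0 => y 0
  | k + 1 => ((1 + c * ((k : ℝ) + 1) : ℝ) : ℂ)⁻¹ *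
      (y (k + 1) + ((c * ((k : ℝ) + 1) : ℝ) : ℂ) * wseq c y k)

lemma wseq_bound {c : ℝ} (hc : 0 ≤ c) {y : ℕ → ℂ} {B : ℝ} (hy : ∀ k, ‖y k‖ ≤ B) (k : ℕ) :
    ‖wseq c y k‖ ≤ B := by
  induction k with
  | zero => exact hy 0
  | succ k ih =>
    have hp : (0 : ℝ) ≤ c * ((k : ℝ) + 1) := by positivity
    rw [wseq, norm_mul, norm_inv, Complex.norm_real, Real.norm_eq_abs,
      abs_of_pos (by linarith), inv_mul_le_iff₀ (by linarith)]
    refine (norm_add_le _ _).trans ?_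
    rw [norm_mul, Complex.norm_real, Real.norm_eq_abs, abs_of_nonneg hp]
    have h1 := hy (k + 1)
    have h2 := mul_le_mul_of_nonneg_left ih hp
    linarith

lemma wseq_add (c : ℝ) (x y : ℕ → ℂ) (k : ℕ) :
    wseq c (x + y) k = wseq c x k + wseq c y k := by
  induction k with
  | zero => rfl
  | succ k ih => simp only [wseq, ih, Pi.add_apply]; ring

lemma wseq_smul (c : ℝ) (r : ℂ) (y : ℕ → ℂ) (k : ℕ) :
    wseq c (r • y) k = r * wseq c y k := by
  induction k with
  | zero => rfl
  | succ k ih => simp only [wseq, ih, Pi.smul_apply, smul_eq_mul]; ring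

/-- The contraction `W` on bounded sequences. -/
def W (c : ℝ) (hc : 0 ≤ c) :
    BoundedContinuousFunction ℕ ℂ →L[ℂ] BoundedContinuousFunction ℕ ℂ :=
  LinearMap.mkContinuous
    { toFun := fun y => BoundedContinuousFunction.ofNormedAddCommGroupDiscrete (wseq c y) ‖y‖
        (wseq_bound hc (fun k => y.norm_coe_le_norm k))
      map_add' := fun x y => by
        ext k
        exact wseq_add c x y k
      map_smul' := fun r y => by
        ext k
        exact wseq_smul c r y k } 1
    (fun y => by
      rw [one_mul]
      refine (BoundedContinuousFunction.norm_le (norm_nonneg _)).2 (fun k => ?_)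
      exact wseq_bound hc (fun k => y.norm_coe_le_norm k) k)

lemma W_apply (c : ℝ) (hc : 0 ≤ c) (y : BoundedContinuousFunction ℕ ℂ) (k : ℕ) :
    W c hc y k = wseq c y k := rfl

lemma W_norm (c : ℝ) (hc : 0 ≤ c) : ‖W c hc‖ ≤ 1 :=
  LinearMap.mkContinuous_norm_le _ zero_le_one _

lemma W_pow (c : ℝ) (hc : 0 ≤ c) (k : ℕ) : ‖W c hc ^ k‖ ≤ 1 := by
  rcases Nat.eq_zero_or_pos k with rfl | hk
  · rw [pow_zero]
    exact ContinuousLinearMap.norm_id_le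
  · exact (norm_pow_le' _ hk).trans (pow_le_one₀ (norm_nonneg _) (W_norm c hc))

lemma W_cesaro (c : ℝ) (hc : 0 ≤ c) (x y : BoundedContinuousFunction ℕ ℂ)
    (h : ∀ k : ℕ, x k = ((k : ℂ) + 1)⁻¹ * ∑ j ∈ Finset.range (k + 1), y j) :
    W c hc ((c : ℂ) • y + ((1 - c : ℝ) : ℂ) • x) = x := by
  ext k
  rw [W_apply]
  induction k with
  | zero =>
    have := h 0
    simp at this
    simp [wseq, this]
    ring
  | succ k ih =>
    rw [wseq, ih]
    have hk := h k
    have hk1 := h (k + 1)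
    rw [Finset.sum_range_succ] at hk1
    have n1 : (k : ℂ) + 1 ≠ 0 := by exact_mod_cast Nat.succ_ne_zero k
    have n2 : (((k + 1 : ℕ) : ℂ)) + 1 ≠ 0 := by exact_mod_cast Nat.succ_ne_zero (k + 1)
    have n3 : ((1 + c * ((k : ℝ) + 1) : ℝ) : ℂ) ≠ 0 := by
      have : (0 : ℝ) < 1 + c * ((k : ℝ) + 1) := by positivity
      exact_mod_cast this.ne'
    rw [eq_inv_mul_iff_mul_eq₀ n1] at hk
    rw [eq_inv_mul_iff_mul_eq₀ n2, ← hk] at hk1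
    rw [inv_mul_eq_iff_eq_mul₀ n3]
    simp only [BoundedContinuousFunction.coe_add, BoundedContinuousFunction.coe_smul,
      Pi.add_apply, smul_eq_mul]
    push_cast at hk1 ⊢
    linear_combination (-(c : ℂ)) * hk1

end CesaroAux

open CesaroAux

/-- For every `α ∈ (0, 1/2)`, the operator `T_α = (1-α)⁻¹ (T - α I)` is
power-bounded, where `T` is the Cesàro operator on `c`. -/
theorem shifted_cesaro_power_bounded
    (T : convSeqs →L[ℂ] convSeqs) (hT : IsCesaro T)
    (α : ℝ) (hα : α ∈ Set.Ioo (0 : ℝ) (1 / 2)) :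
    ∃ C : ℝ, ∀ n : ℕ,
      ‖(((1 : ℂ) - (α : ℂ))⁻¹ • (T - (α : ℂ) • (1 : convSeqs →L[ℂ] convSeqs))) ^ n‖ ≤ C := by
  obtain ⟨hα0, hα1⟩ := hα
  have h1α : 0 < 1 - α := by linarith
  obtain ⟨β, hβ⟩ : ∃ β : ℝ, β = α / (1 - α) := ⟨_, rfl⟩
  have hβ0 : 0 < β := by rw [hβ]; positivity
  have hβ1 : β < 1 := by rw [hβ, div_lt_one h1α]; linarith
  obtain ⟨q, hq⟩ : ∃ q : ℝ, q = (1 + β) / 2 := ⟨_, rfl⟩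
  have hβq : β < q := by linarith
  have hq1 : q < 1 := by linarith
  have hq0 : 0 ≤ q := by linarith
  have hc : 0 ≤ 1 - q := by linarith
  obtain ⟨C, hC⟩ := coeff_bound hβ0 hβq hq1
  refine ⟨C, fun n => ?_⟩
  set w := W (1 - q) hc with hw
  have hwp : ∀ k : ℕ, ‖w ^ k‖ ≤ 1 := W_pow _ _
  set S := ((1 : ℂ) - (α : ℂ))⁻¹ • (T - (α : ℂ) • (1 : convSeqs →L[ℂ] convSeqs)) with hS
  have hα' : (1 : ℂ) - (α : ℂ) ≠ 0 := by exact_mod_cast h1α.ne'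
  have hβc : (β : ℂ) = (α : ℂ) / (1 - α) := by rw [hβ]; push_cast; rfl
  -- intertwining
  have key : ∀ x : convSeqs, ((S x : convSeqs) : BoundedContinuousFunction ℕ ℂ)
      = ev w (F β q) (x : BoundedContinuousFunction ℕ ℂ) := by
    intro x
    have h1 := W_cesaro (1 - q) hc (T x : BoundedContinuousFunction ℕ ℂ)
      (x : BoundedContinuousFunction ℕ ℂ) (hT x)
    rw [← hw, sub_sub_cancel, map_add, map_smul, map_smul] at h1
    set y : BoundedContinuousFunction ℕ ℂ := (T x : BoundedContinuousFunction ℕ ℂ) with hy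
    set z : BoundedContinuousFunction ℕ ℂ := (x : BoundedContinuousFunction ℕ ℂ) with hz
    have hg := ev_G (a := w) hwp hq0 hq1
    have hSx : ((S x : convSeqs) : BoundedContinuousFunction ℕ ℂ)
        = ((1 : ℂ) - (α : ℂ))⁻¹ • (y - (α : ℂ) • z) := rfl
    have hFG : F β q = G q * (PowerSeries.C ((1 - q + β : ℝ) : ℂ) * PowerSeries.X
        - PowerSeries.C (β : ℂ)) := mul_comm _ _
    have hevF : ev w (F β q) z = ev w (G q) (((1 - q + β : ℝ) : ℂ) • w z - (β : ℂ) • z) := by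
      rw [hFG, ev_mul hwp (L1_G hq0 hq1) (((L1_C _).mul L1_X).sub (L1_C _)),
        ev_sub hwp ((L1_C _).mul L1_X) (L1_C _), ev_mul hwp (L1_C _) L1_X, ev_C, ev_C, ev_X,
        smul_mul_assoc, one_mul]
      rfl
    have hga : ∀ v, ev w (G q) (v - (q : ℂ) • w v) = v := by
      intro v
      have := congrArg (fun L => L v) hg
      exact this
    have hval : ((1 : ℂ) - (α : ℂ))⁻¹ • (y - (α : ℂ) • z)
        - (q : ℂ) • w (((1 : ℂ) - (α : ℂ))⁻¹ • (y - (α : ℂ) • z))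
        = ((1 - q + β : ℝ) : ℂ) • w z - (β : ℂ) • z := by
      rw [map_smul, map_sub, map_smul]
      have h1' : y = ((1 - q : ℝ) : ℂ) • w z + (q : ℂ) • w y := h1.symm
      have h2 : y - (q : ℂ) • w y = ((1 - q : ℝ) : ℂ) • w z := by
        rw [sub_eq_iff_eq_add]; exact h1'
      have h3 : ((1 : ℂ) - (α : ℂ))⁻¹ • (y - (α : ℂ) • z)
        - (q : ℂ) • ((1 : ℂ) - (α : ℂ))⁻¹ • (w y - (α : ℂ) • w z)
        = ((1 : ℂ) - (α : ℂ))⁻¹ • (y - (q : ℂ) • w y)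
          + ((q : ℂ) * (((1 : ℂ) - (α : ℂ))⁻¹ * α)) • w z
          - (((1 : ℂ) - (α : ℂ))⁻¹ * α) • z := by module
      rw [h3, h2, smul_smul, ← add_smul]
      congr 2
      · push_cast; rw [hβc]; field_simp; ring
      · rw [hβc]; field_simp
    rw [hSx, hevF, ← hval, hga]
  have keyn : ∀ x : convSeqs, (((S ^ n) x : convSeqs) : BoundedContinuousFunction ℕ ℂ)
      = ev w (F β q ^ n) (x : BoundedContinuousFunction ℕ ℂ) := by
    rw [ev_pow hwp (L1_F hq0 hq1)]
    clear hC
    induction n with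
    | zero => intro x; rfl
    | succ n ih =>
      intro x
      rw [pow_succ', pow_succ']
      have h1 : (S * S ^ n) x = S ((S ^ n) x) := rfl
      rw [h1, key, ih x]
      rfl
  have hC0 : 0 ≤ C := le_trans (tsum_nonneg fun _ => norm_nonneg _) (hC n)
  refine ContinuousLinearMap.opNorm_le_bound _ hC0 (fun x => ?_)
  have hnx : ‖(S ^ n) x‖ = ‖(((S ^ n) x : convSeqs) : BoundedContinuousFunction ℕ ℂ)‖ := rfl
  rw [hnx, keyn x]
  refine (ContinuousLinearMap.le_opNorm _ _).trans ?_
  refine mul_le_mul_of_nonneg_right ?_ (norm_nonneg _)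
  exact (norm_ev_le hwp ((L1_F hq0 hq1).pow n)).trans (hC n)
end
end

section
/- There is no sequence (r_n) of positive reals with r_n = o(n^{−1/2}) such that ‖Tⁿx − Px‖_∞ = O(r_n) for every x ∈ c with x_0 = lim_k x_k and ∑_{k≥1}(x_k − x_0)/k convergent; equivalently, lim sup_{n→∞} n^{1/2}‖Tⁿ(I−T)‖ > 0 for the Cesàro operator T on c. -/
open Filter Topology

noncomputable section

lemma seq_decay (a : ℕ → ℝ) (ha : ∀ j, 0 ≤ a j) (δ : ℝ) (hδ : 0 < δ) (J : ℕ)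
    (h : ∀ j ≥ J, ((j : ℝ) + 1) * a (j + 1) ≤ ((j : ℝ) - δ) * a j) :
    Summable a ∧ Tendsto (fun j : ℕ => (j : ℝ) * a j) atTop (nhds 0) := by
  have hsum : Summable a := by
    rw [← summable_nat_add_iff J]
    have key : ∀ n : ℕ, δ * ∑ i ∈ Finset.range n, a (i + J)
        ≤ J * a J - ((n + J : ℕ) : ℝ) * a (n + J) := by
      intro n
      induction n with
      | zero => simp
      | succ k ih =>
        rw [Finset.sum_range_succ, mul_add]
        have h1 := h (k + J) (by omega)
        have e : k + 1 + J = k + J + 1 := by omega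
        rw [e]
        push_cast at h1 ih ⊢
        nlinarith
    refine summable_of_sum_range_le (c := J * a J / δ) (fun n => ha _) (fun n => ?_)
    rw [le_div_iff₀ hδ]
    have := key n
    have h2 : 0 ≤ ((n + J : ℕ) : ℝ) * a (n + J) := mul_nonneg (Nat.cast_nonneg _) (ha _)
    linarith
  refine ⟨hsum, ?_⟩
  set f : ℕ → ℝ := fun n => ((n + J : ℕ) : ℝ) * a (n + J) with hf
  have hf0 : ∀ n, 0 ≤ f n := fun n => mul_nonneg (Nat.cast_nonneg _) (ha _)
  have hanti : Antitone f := by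
    refine antitone_nat_of_succ_le (fun n => ?_)
    have h1 := h (n + J) (by omega)
    have e : n + 1 + J = n + J + 1 := by omega
    have h3 := mul_nonneg hδ.le (ha (n + J))
    simp only [hf, e]
    push_cast at h1 ⊢
    nlinarith
  have hlim := tendsto_atTop_ciInf hanti ⟨0, by rintro _ ⟨n, rfl⟩; exact hf0 n⟩
  set L := ⨅ n, f n with hL
  have hL0 : 0 ≤ L := ge_of_tendsto' hlim hf0
  have hLf : ∀ n, L ≤ f n := fun n => hanti.le_of_tendsto hlim n
  have hLz : L = 0 := by
    by_contra hne
    have hpos : 0 < L := lt_of_le_of_ne hL0 (Ne.symm hne)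
    apply Real.not_summable_one_div_natCast
    rw [← summable_nat_add_iff (J + 1)]
    have h4 : Summable (fun n => L⁻¹ * a (n + (J + 1))) :=
      ((summable_nat_add_iff (J + 1)).2 hsum).mul_left _
    refine Summable.of_nonneg_of_le (fun n => by positivity) (fun n => ?_) h4
    have h5 := hLf (n + 1)
    have e : n + 1 + J = n + (J + 1) := by omega
    simp only [hf, e] at h5
    have h6 : (0 : ℝ) < ((n + (J + 1) : ℕ) : ℝ) := by positivity
    rw [div_le_iff₀ h6, mul_assoc, inv_mul_eq_div, le_div_iff₀ hpos]
    linarith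
  rw [hLz] at hlim
  exact (tendsto_add_atTop_iff_nat J).1 hlim

/-- Coefficients of the eigenfunctional. -/
def phiC (μ : ℂ) (k : ℕ) : ℂ := ∏ i ∈ Finset.range k, (1 - μ / ((i : ℂ) + 1))

lemma phiC_succ (μ : ℂ) (k : ℕ) : phiC μ (k + 1) = phiC μ k * (1 - μ / ((k : ℂ) + 1)) := by
  simp [phiC, Finset.prod_range_succ]

lemma phiC_decay (s t : ℝ) (hs : 0 < s) :
    Summable (fun k => ‖phiC ⟨1 + s, t⟩ k‖) ∧
      Tendsto (fun j : ℕ => (j : ℝ) * ‖phiC ⟨1 + s, t⟩ j‖) atTop (nhds 0) := by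
  obtain ⟨J, hJ⟩ := exists_nat_gt ((s ^ 2 + t ^ 2) / s + s)
  refine seq_decay _ (fun j => norm_nonneg _) (s / 2) (by positivity) J (fun j hj => ?_)
  have hj' : (J : ℝ) ≤ j := by exact_mod_cast hj
  have hj2 : (s ^ 2 + t ^ 2) / s + s < j := lt_of_lt_of_le hJ hj'
  have hq : 0 ≤ (s ^ 2 + t ^ 2) / s := by positivity
  have hj3 : (s ^ 2 + t ^ 2) < j * s := by
    rw [← div_lt_iff₀ hs]; linarith
  rw [phiC_succ, norm_mul]
  have hne : (j : ℂ) + 1 ≠ 0 := by exact_mod_cast Nat.succ_ne_zero j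
  have e : (1 - (⟨1 + s, t⟩ : ℂ) / ((j : ℂ) + 1)) = (⟨j - s, -t⟩ : ℂ) / ((j : ℂ) + 1) := by
    field_simp
    apply Complex.ext <;> simp
    ring
  have en : ‖(j : ℂ) + 1‖ = (j : ℝ) + 1 := by
    have : ((j : ℂ) + 1) = ((j + 1 : ℕ) : ℂ) := by push_cast; rfl
    rw [this, Complex.norm_natCast]; push_cast; rfl
  have hb : ‖(⟨j - s, -t⟩ : ℂ)‖ ≤ j - s / 2 := by
    refine abs_le_of_sq_le_sq' ?_ ?_ |>.2
    · rw [Complex.sq_norm, Complex.normSq_apply]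
      simp only
      nlinarith [sq_nonneg s, sq_nonneg t]
    · linarith
  rw [e, norm_div, en]
  have hp : (0 : ℝ) < (j : ℝ) + 1 := by positivity
  calc ((j : ℝ) + 1) * (‖phiC ⟨1 + s, t⟩ j‖ * (‖(⟨j - s, -t⟩ : ℂ)‖ / ((j : ℝ) + 1)))
      = ‖(⟨j - s, -t⟩ : ℂ)‖ * ‖phiC ⟨1 + s, t⟩ j‖ := by field_simp
    _ ≤ _ := by gcongr

lemma convSeqs_closed : IsClosed (convSeqs : Set (BoundedContinuousFunction ℕ ℂ)) := by
  have : (convSeqs : Set (BoundedContinuousFunction ℕ ℂ)) = {x | CauchySeq (fun k => x k)} := by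
    ext x
    constructor
    · rintro ⟨l, hl⟩; exact hl.cauchySeq
    · intro h; exact cauchySeq_tendsto_of_complete h
  rw [this]
  refine isClosed_of_closure_subset (fun x hx => ?_)
  rw [Metric.mem_closure_iff] at hx
  rw [Set.mem_ofPred_eq, Metric.cauchySeq_iff']
  intro ε hε
  obtain ⟨y, hy, hxy⟩ := hx (ε / 3) (by positivity)
  obtain ⟨N, hN⟩ := Metric.cauchySeq_iff'.1 hy (ε / 3) (by positivity)
  refine ⟨N, fun n hn => ?_⟩
  have h1 := hN n hn
  have h2 := BoundedContinuousFunction.dist_coe_le_dist (f := x) (g := y) n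
  have h3 := BoundedContinuousFunction.dist_coe_le_dist (f := x) (g := y) N
  rw [dist_comm (x N)] at h3
  have h4 := dist_triangle4 (x n) (y n) (y N) (x N)
  linarith

instance convSeqs_complete : CompleteSpace convSeqs := convSeqs_closed.completeSpace_coe

lemma cesaro_fin (μ : ℂ) (hμ : μ ≠ 0) (x : ℕ → ℂ) (N : ℕ) :
    ∑ k ∈ Finset.range N, phiC μ k * (((k : ℂ) + 1)⁻¹ * ∑ j ∈ Finset.range (k + 1), x j)
      = μ⁻¹ * (∑ k ∈ Finset.range N, phiC μ k * x k - phiC μ N * ∑ j ∈ Finset.range N, x j) := by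
  induction N with
  | zero => simp
  | succ n ih =>
    have hne : (n : ℂ) + 1 ≠ 0 := by exact_mod_cast Nat.succ_ne_zero n
    rw [Finset.sum_range_succ, ih, Finset.sum_range_succ _ n, phiC_succ,
      Finset.sum_range_succ (fun k => phiC μ k * x k) n]
    field_simp
    ring

lemma phi_summable (μ : ℂ) (h : Summable (fun k => ‖phiC μ k‖)) (x : convSeqs) :
    Summable (fun k => ‖phiC μ k * (x : BoundedContinuousFunction ℕ ℂ) k‖) := by
  refine Summable.of_nonneg_of_le (fun k => norm_nonneg _) (fun k => ?_) (h.mul_right ‖x‖)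
  rw [norm_mul]
  gcongr
  exact BoundedContinuousFunction.norm_coe_le_norm (x : BoundedContinuousFunction ℕ ℂ) k

/-- The eigenfunctional. -/
def phiF (μ : ℂ) (h : Summable (fun k => ‖phiC μ k‖)) : convSeqs →L[ℂ] ℂ :=
  LinearMap.mkContinuous
    { toFun := fun x => ∑' k, phiC μ k * (x : BoundedContinuousFunction ℕ ℂ) k
      map_add' := by
        intro x y
        rw [← (phi_summable μ h x).of_norm.tsum_add (phi_summable μ h y).of_norm]
        simp [mul_add]
      map_smul' := by
        intro c x
        simp only [RingHom.id_apply, smul_eq_mul]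
        rw [← tsum_mul_left]
        congr 1
        ext k
        simp
        ring }
    (∑' k, ‖phiC μ k‖) (by
      intro x
      simp only [LinearMap.coe_mk, AddHom.coe_mk]
      refine (norm_tsum_le_tsum_norm (phi_summable μ h x)).trans ?_
      rw [← tsum_mul_right]
      refine (phi_summable μ h x).tsum_le_tsum (fun k => ?_) (h.mul_right ‖x‖)
      rw [norm_mul]
      gcongr
      exact BoundedContinuousFunction.norm_coe_le_norm (x : BoundedContinuousFunction ℕ ℂ) k)

lemma phiF_apply (μ : ℂ) (h : Summable (fun k => ‖phiC μ k‖)) (x : convSeqs) :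
    phiF μ h x = ∑' k, phiC μ k * (x : BoundedContinuousFunction ℕ ℂ) k := rfl

lemma phiF_eigen (T : convSeqs →L[ℂ] convSeqs) (hT : IsCesaro T) (μ : ℂ) (hμ : μ ≠ 0)
    (h : Summable (fun k => ‖phiC μ k‖))
    (h0 : Tendsto (fun j : ℕ => (j : ℝ) * ‖phiC μ j‖) atTop (nhds 0)) (x : convSeqs) :
    phiF μ h (T x) = μ⁻¹ * phiF μ h x := by
  have h1 := (phi_summable μ h (T x)).of_norm.hasSum.tendsto_sum_nat
  have h2 := (phi_summable μ h x).of_norm.hasSum.tendsto_sum_nat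
  rw [← phiF_apply μ h] at h1 h2
  have h3 : Tendsto (fun N => phiC μ N *
      ∑ j ∈ Finset.range N, (x : BoundedContinuousFunction ℕ ℂ) j) atTop (nhds 0) := by
    have h4 := h0.mul_const ‖x‖
    rw [zero_mul] at h4
    refine squeeze_zero_norm (fun N => ?_) h4
    rw [norm_mul]
    have : ‖∑ j ∈ Finset.range N, (x : BoundedContinuousFunction ℕ ℂ) j‖ ≤ N * ‖x‖ := by
      refine (norm_sum_le_of_le _ (fun j _ =>
        BoundedContinuousFunction.norm_coe_le_norm
          (x : BoundedContinuousFunction ℕ ℂ) j)).trans ?_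
      rw [Finset.sum_const, Finset.card_range, nsmul_eq_mul]
      exact le_refl _
    calc _ ≤ ‖phiC μ N‖ * (N * ‖x‖) := by gcongr
      _ = _ := by ring
  have h5 := (h2.sub h3).const_mul μ⁻¹
  rw [sub_zero] at h5
  refine tendsto_nhds_unique h1 (h5.congr (fun N => ?_))
  rw [← cesaro_fin μ hμ]
  simp only [hT x]

/-- The first unit vector. -/
def e0 : convSeqs := ⟨BoundedContinuousFunction.ofNormedAddCommGroupDiscrete
    (fun k : ℕ => if k = 0 then (1 : ℂ) else 0) 1 (by intro k; split_ifs <;> simp),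
  0, by
    refine tendsto_const_nhds.congr' ?_
    filter_upwards [eventually_ge_atTop 1] with k hk
    simp [show k ≠ 0 by omega]⟩

lemma phiF_ne (μ : ℂ) (h : Summable (fun k => ‖phiC μ k‖)) : phiF μ h ≠ 0 := by
  intro hz
  have h1 : phiF μ h e0 = 0 := by rw [hz]; rfl
  rw [phiF_apply, tsum_eq_single 0] at h1
  · simp [e0, phiC] at h1
  · intro k hk
    simp [e0, hk]

lemma lower_aux (T : convSeqs →L[ℂ] convSeqs) (hT : IsCesaro T) (s t : ℝ) (hs : 0 < s) (n : ℕ) :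
    ‖(⟨1 + s, t⟩ : ℂ)⁻¹ ^ n * (1 - (⟨1 + s, t⟩ : ℂ)⁻¹)‖ ≤ ‖T ^ n * (1 - T)‖ := by
  obtain ⟨h, h0⟩ := phiC_decay s t hs
  set μ : ℂ := ⟨1 + s, t⟩ with hμd
  have hμ : μ ≠ 0 := by
    intro hz
    have := congrArg Complex.re hz
    simp [hμd] at this
    linarith
  have he := phiF_eigen T hT μ hμ h h0
  have hp : ∀ (n : ℕ) (x : convSeqs), phiF μ h ((T ^ n) x) = μ⁻¹ ^ n * phiF μ h x := by
    intro n
    induction n with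
    | zero => intro x; simp
    | succ k ih =>
      intro x
      rw [pow_succ, mul_apply_eq_comp, ih, he]
      ring
  have hc : (phiF μ h).comp (T ^ n * (1 - T)) = (μ⁻¹ ^ n * (1 - μ⁻¹)) • phiF μ h := by
    ext x
    simp only [ContinuousLinearMap.comp_apply, mul_apply_eq_comp, hp,
      sub_apply, one_apply_eq_self, map_sub, he,
      smul_apply, smul_eq_mul]
    ring
  have h6 := (phiF μ h).opNorm_comp_le (T ^ n * (1 - T))
  rw [hc, norm_smul, mul_comm] at h6
  refine le_of_mul_le_mul_left h6 (lt_of_le_of_ne (norm_nonneg _) (fun hz => ?_))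
  apply phiF_ne μ h
  ext x
  have h7 := (phiF μ h).le_opNorm x
  rw [← hz, zero_mul] at h7
  simpa using h7

lemma lower_bound (T : convSeqs →L[ℂ] convSeqs) (hT : IsCesaro T) (n : ℕ) (hn : 1 ≤ n) :
    Real.exp (-4) / Real.sqrt n ≤ ‖T ^ n * (1 - T)‖ := by
  have hn' : (1 : ℝ) ≤ n := by exact_mod_cast hn
  have hn0 : (0 : ℝ) < n := by linarith
  have hsq : 0 < Real.sqrt n := Real.sqrt_pos.2 hn0
  refine le_trans ?_ (lower_aux T hT (1 / n) (1 / Real.sqrt n) (by positivity) n)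
  set μ : ℂ := ⟨1 + 1 / n, 1 / Real.sqrt n⟩ with hμd
  have hμ : μ ≠ 0 := by
    intro hz
    have := congrArg Complex.re hz
    simp only [hμd, Complex.zero_re] at this
    have : (0 : ℝ) < 1 + 1 / n := by positivity
    linarith
  have hpos : 0 < ‖μ‖ := norm_pos_iff.2 hμ
  have e : μ⁻¹ ^ n * (1 - μ⁻¹) = (μ - 1) / μ ^ (n + 1) := by
    have : (1 : ℂ) - μ⁻¹ = (μ - 1) / μ := by field_simp
    rw [this, inv_pow, pow_succ]
    field_simp
  rw [e, norm_div, norm_pow]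
  have h1 : 1 / Real.sqrt n ≤ ‖μ - 1‖ := by
    have := Complex.abs_im_le_norm (μ - 1)
    simp only [hμd, Complex.sub_im, Complex.one_im, sub_zero] at this
    exact (le_abs_self _).trans this
  have h2 : ‖μ‖ ^ 2 ≤ Real.exp (4 / n) := by
    rw [Complex.sq_norm, Complex.normSq_apply]
    have h3 : 1 / Real.sqrt n * (1 / Real.sqrt n) = 1 / n := by
      rw [div_mul_div_comm, Real.mul_self_sqrt hn0.le, one_mul]
    have h4 : (1 : ℝ) / n ≤ 1 := by rw [div_le_one hn0]; exact hn'
    have h5 : (0 : ℝ) ≤ 1 / n := by positivity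
    have h6 := Real.add_one_le_exp ((4 : ℝ) / n)
    have h7 : (4 : ℝ) / n = 4 * (1 / n) := by ring
    rw [h7] at h6 ⊢
    simp only [hμd, h3]
    nlinarith
  have h3 : ‖μ‖ ^ (n + 1) ≤ Real.exp 4 := by
    have h4 : (‖μ‖ ^ (n + 1)) ^ 2 ≤ Real.exp 4 ^ 2 := by
      calc (‖μ‖ ^ (n + 1)) ^ 2 = (‖μ‖ ^ 2) ^ (n + 1) := by ring
        _ ≤ Real.exp (4 / n) ^ (n + 1) := by gcongr
        _ = Real.exp (((n + 1 : ℕ) : ℝ) * (4 / n)) := by rw [Real.exp_nat_mul]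
        _ ≤ Real.exp (((2 : ℕ) : ℝ) * 4) := by
          apply Real.exp_le_exp.2
          push_cast
          rw [← mul_div_assoc, div_le_iff₀ hn0]
          linarith
        _ = _ := by rw [Real.exp_nat_mul]
    exact (abs_le_of_sq_le_sq' h4 (Real.exp_pos _).le).2
  calc Real.exp (-4) / Real.sqrt n = (1 / Real.sqrt n) / Real.exp 4 := by
        rw [Real.exp_neg]; field_simp
    _ ≤ _ := by gcongr

lemma range_tel (T : convSeqs →L[ℂ] convSeqs) (hT : IsCesaro T) (y : convSeqs) (n : ℕ) :
    ∑ k ∈ Finset.Icc 1 n, (((1 - T) y : convSeqs) : BoundedContinuousFunction ℕ ℂ) k / (k : ℂ)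
      = (T y : BoundedContinuousFunction ℕ ℂ) n - (T y : BoundedContinuousFunction ℕ ℂ) 0 := by
  induction n with
  | zero => simp
  | succ n ih =>
    rw [Finset.sum_Icc_succ_top (by omega), ih]
    have e : (((1 - T) y : convSeqs) : BoundedContinuousFunction ℕ ℂ) (n + 1)
      = (y : BoundedContinuousFunction ℕ ℂ) (n + 1)
        - (T y : BoundedContinuousFunction ℕ ℂ) (n + 1) := by simp
    rw [e, hT y n, hT y (n + 1), Finset.sum_range_succ _ (n + 1)]
    have hne : (n : ℂ) + 1 ≠ 0 := by exact_mod_cast Nat.succ_ne_zero n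
    have hne2 : (n : ℂ) + 1 + 1 ≠ 0 := by exact_mod_cast Nat.succ_ne_zero (n + 1)
    push_cast
    field_simp
    ring

lemma range_zero (T : convSeqs →L[ℂ] convSeqs) (hT : IsCesaro T) (y : convSeqs) :
    (((1 - T) y : convSeqs) : BoundedContinuousFunction ℕ ℂ) 0 = 0 := by
  simp [hT y 0]

lemma range_lim (T : convSeqs →L[ℂ] convSeqs) (hT : IsCesaro T) (y : convSeqs) :
    Tendsto (fun k : ℕ => (((1 - T) y : convSeqs) : BoundedContinuousFunction ℕ ℂ) k)
      atTop (nhds 0) := by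
  obtain ⟨l, hl⟩ := y.2
  have h1 : Tendsto (fun k : ℕ => (T y : BoundedContinuousFunction ℕ ℂ) k) atTop (nhds l) := by
    have h2 := (tendsto_add_atTop_iff_nat 1).2 hl.cesaro_smul
    refine h2.congr (fun k => ?_)
    rw [hT y k]
    simp
  have := hl.sub h1
  rw [sub_self] at this
  exact this.congr (fun k => by simp)

/-- No rate `r_n = o(n^{-1/2})` can bound `‖Tⁿx − Px‖_∞` for all `x ∈ c` with
`x₀ = lim_k x_k` and `∑_{k≥1}(x_k - x₀)/k` convergent; equivalently,
`limsup_n n^{1/2} ‖Tⁿ(I − T)‖ > 0`. -/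
theorem rate_optimality
    (T : convSeqs →L[ℂ] convSeqs) (hT : IsCesaro T) :
    (¬ ∃ r : ℕ → ℝ, (∀ n, 0 < r n) ∧
        Tendsto (fun n : ℕ => r n * Real.sqrt n) atTop (nhds 0) ∧
        ∀ x p : convSeqs,
          (∀ k : ℕ, (p : BoundedContinuousFunction ℕ ℂ) k
            = (x : BoundedContinuousFunction ℕ ℂ) 0) →
          Tendsto (fun k : ℕ => (x : BoundedContinuousFunction ℕ ℂ) k) atTop
            (nhds ((x : BoundedContinuousFunction ℕ ℂ) 0)) →
          (∃ S : ℂ, Tendsto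
            (fun n : ℕ => ∑ k ∈ Finset.Icc 1 n,
              ((x : BoundedContinuousFunction ℕ ℂ) k
                - (x : BoundedContinuousFunction ℕ ℂ) 0) / (k : ℂ))
            atTop (nhds S)) →
          ∃ C : ℝ, ∀ n : ℕ, ‖(T ^ n) x - p‖ ≤ C * r n) ∧
    ∃ c > (0 : ℝ), ∀ N : ℕ, ∃ n ≥ N,
      c / Real.sqrt n ≤ ‖T ^ n * (1 - T)‖ := by
  have hlow : ∃ c > (0 : ℝ), ∀ N : ℕ, ∃ n ≥ N,
      c / Real.sqrt n ≤ ‖T ^ n * (1 - T)‖ :=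
    ⟨Real.exp (-4), Real.exp_pos _, fun N =>
      ⟨N + 1, by omega, lower_bound T hT (N + 1) (by omega)⟩⟩
  refine ⟨?_, hlow⟩
  rintro ⟨r, hr, hlim, H⟩
  have hub : ∃ C, ∀ n : ℕ, ‖((r n : ℂ)⁻¹) • (T ^ n * (1 - T))‖ ≤ C := by
    apply banach_steinhaus
    intro y
    obtain ⟨l, hl⟩ := (T y).2
    obtain ⟨C, hC⟩ := H ((1 - T) y) 0 (fun k => by rw [range_zero T hT]; rfl)
      (by rw [range_zero T hT]; exact range_lim T hT y)
      (by
        refine ⟨_, (hl.sub_const ((T y : BoundedContinuousFunction ℕ ℂ) 0)).congr (fun n => ?_)⟩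
        rw [← range_tel T hT y n, range_zero T hT]
        simp only [sub_zero])
    refine ⟨C, fun n => ?_⟩
    have h1 := hC n
    rw [sub_zero] at h1
    rw [smul_apply, norm_smul, norm_inv, Complex.norm_real,
      Real.norm_of_nonneg (hr n).le, inv_mul_le_iff₀ (hr n), mul_comm]
    exact h1
  obtain ⟨C, hC⟩ := hub
  have h2 : ∀ n : ℕ, 1 ≤ n → Real.exp (-4) ≤ C * (r n * Real.sqrt n) := by
    intro n hn
    have hC0 : 0 ≤ C := (ContinuousLinearMap.opNorm_nonneg _).trans (hC n)
    have h3 : ‖T ^ n * (1 - T)‖ ≤ r n * C := by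
      refine ContinuousLinearMap.opNorm_le_bound _ (mul_nonneg (hr n).le hC0) (fun y => ?_)
      have h7 := ContinuousLinearMap.le_of_opNorm_le _ (hC n) y
      rw [smul_apply, norm_smul, norm_inv, Complex.norm_real,
        Real.norm_of_nonneg (hr n).le, inv_mul_le_iff₀ (hr n)] at h7
      linarith
    have hsq : 0 < Real.sqrt n := Real.sqrt_pos.2 (by exact_mod_cast hn)
    have h4 := (lower_bound T hT n hn).trans h3
    rw [div_le_iff₀ hsq] at h4
    linarith
  have h5 := hlim.const_mul C
  rw [mul_zero] at h5
  have h6 : Real.exp (-4) ≤ 0 := by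
    refine ge_of_tendsto h5 ?_
    filter_upwards [eventually_ge_atTop 1] with n hn using h2 n hn
  exact absurd (Real.exp_pos (-4)) (not_lt.2 h6)
end
end
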